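/- arXiv:1305.7240 — 2 statements merged into one kernel-verified Lean document; each statement's English description precedes it below -/
import Mathlib

section
/- Let d, m ≥ 1 be integers and let r be a real exponent satisfying r > 2 in the case m·d ≤ 2, and r ≥ m·d in the case m·d > 2. Then there exists a constant C = C(d, m, r) > 0 such that for every real-valued V ∈ L^r(ℝ^{md}) and every Schwartz function ψ on ℝ^{md} (with variables grouped as x = (x₁, …, x_m), x_j ∈ ℝ^d), one has |∫_{ℝ^{md}} V(x) |ψ(x)|² dx| ≤ C ‖V‖_{L^r(ℝ^{md})} · ∫_{ℝ^{md}} ∏_{j=1}^{m} (1 + |ξ_j|²) |ψ̂(ξ₁, …, ξ_m)|² dξ. -/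
open MeasureTheory
open scoped FourierTransform ENNReal
open scoped NNReal LineDeriv

theorem gns_aux {ι : Type*} [Fintype ι] [Nonempty ι] :
    ∃ p : ℝ≥0∞, ENNReal.HolderConjugate (Fintype.card ι : ℝ≥0∞) p ∧ ∃ K : ℝ≥0,
      ∀ u : EuclideanSpace ℝ ι → ℝ, ContDiff ℝ 1 u → HasCompactSupport u →
        eLpNorm u p volume ≤ K * eLpNorm (fderiv ℝ u) 1 volume := by
  classical
  rcases Nat.lt_or_ge 1 (Fintype.card ι) with h | h
  · have hc : NNReal.HolderConjugate (Fintype.card ι : ℝ≥0)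
        (NNReal.conjExponent (Fintype.card ι : ℝ≥0)) :=
      NNReal.HolderConjugate.conjExponent (by exact_mod_cast h)
    refine ⟨(NNReal.conjExponent (Fintype.card ι : ℝ≥0) : ℝ≥0), ?_, _, fun u hu h2u =>
      eLpNorm_le_eLpNorm_fderiv_one volume hu h2u (by simpa using hc)⟩
    simpa using hc.coe_ennreal
  · have h1 : Fintype.card ι = 1 := le_antisymm h Fintype.card_pos
    obtain ⟨hU⟩ := Fintype.card_eq_one_iff_nonempty_unique.1 h1
    refine ⟨⊤, by rw [h1]; simpa using (inferInstance : ENNReal.HolderConjugate 1 ⊤), 1, ?_⟩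
    intro u hu h2u
    let L : ℝ ≃ₗᵢ[ℝ] EuclideanSpace ℝ ι := ((OrthonormalBasis.singleton Unit ℝ).reindex (Equiv.ofUnique Unit ι)).repr
    rw [eLpNorm_exponent_top, eLpNorm_one_eq_lintegral_enorm]
    apply eLpNormEssSup_le_of_ae_enorm_bound
    refine Filter.Eventually.of_forall fun x => ?_
    have hL : ContDiff ℝ 1 (u ∘ L) := hu.comp L.contDiff
    have hLc : HasCompactSupport (u ∘ L) := h2u.comp_homeomorph L.toHomeomorph
    have := HasCompactSupport.enorm_le_lintegral_Ici_deriv hL hLc (L.symm x)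
    simp only [Function.comp_apply, LinearIsometryEquiv.apply_symm_apply] at this
    refine this.trans ((setLIntegral_le_lintegral _ _).trans ?_)
    rw [ENNReal.coe_one, one_mul, ← L.measurePreserving.lintegral_comp_emb
      L.toHomeomorph.measurableEmbedding]
    refine lintegral_mono fun y => ?_
    have hd : HasDerivAt (u ∘ L) (fderiv ℝ u (L y) (L 1)) y := by
      have h1 : HasFDerivAt u (fderiv ℝ u (L y)) (L y) :=
        ((hu.differentiable (by simp)) (L y)).hasFDerivAt
      have h2 : HasDerivAt (fun t => L t) (L 1) y := by
        simpa using (L.toContinuousLinearEquiv.hasFDerivAt (x := y)).hasDerivAt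
      exact h1.comp_hasDerivAt y h2
    have e1 : deriv (u ∘ L) y = fderiv ℝ u (L y) (L 1) := hd.deriv
    show ‖deriv (u ∘ L) y‖ₑ ≤ _
    rw [e1]
    refine (ContinuousLinearMap.le_opENorm _ _).trans ?_
    have : ‖L 1‖ₑ = 1 := by rw [← ofReal_norm]; simp
    rw [this, mul_one]

theorem sob_aux {ι : Type*} [Fintype ι] [Nonempty ι] :
    ∃ p : ℝ≥0∞, ENNReal.HolderConjugate (Fintype.card ι : ℝ≥0∞) p ∧ ∃ K : ℝ≥0,
      ∀ ψ : SchwartzMap (EuclideanSpace ℝ ι) ℂ,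
        eLpNorm (fun x => ‖ψ x‖ ^ 2) p volume ≤
          K * ∫⁻ x, ENNReal.ofReal (‖ψ x‖ ^ 2 + ‖fderiv ℝ ψ x‖ ^ 2) := by
  obtain ⟨p, hp, K, hK⟩ := gns_aux (ι := ι)
  let χ : ContDiffBump (0 : EuclideanSpace ℝ ι) := ⟨1, 2, by norm_num, by norm_num⟩
  have hχ : ContDiff ℝ 1 (χ : EuclideanSpace ℝ ι → ℝ) := χ.contDiff
  obtain ⟨M, hM⟩ := (hχ.continuous_fderiv (by simp)).bounded_above_of_compact_support
    (χ.hasCompactSupport.fderiv (𝕜 := ℝ))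
  have hM0 : 0 ≤ M := (norm_nonneg _).trans (hM 0)
  refine ⟨p, hp, K * Real.toNNReal (1 + M), fun ψ => ?_⟩
  have hu : ContDiff ℝ 1 (fun x => ‖ψ x‖ ^ 2) := (ψ.smooth 1).norm_sq ℝ
  let c : ℕ → ℝ := fun k => ((k : ℝ) + 1)⁻¹
  have hc0 : ∀ k, 0 < c k := fun k => by positivity
  have hc1 : ∀ k, c k ≤ 1 := fun k => by
    apply inv_le_one_of_one_le₀; linarith [(Nat.cast_nonneg k : (0:ℝ) ≤ k)]
  let g : ℕ → EuclideanSpace ℝ ι → ℝ := fun k x => χ (c k • x)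
  have hg : ∀ k, ContDiff ℝ 1 (g k) := fun k => hχ.comp (contDiff_id.const_smul (c k))
  have hgc : ∀ k, HasCompactSupport (g k) := fun k =>
    χ.hasCompactSupport.comp_homeomorph (Homeomorph.smulOfNeZero (c k) (hc0 k).ne')
  have hg1 : ∀ k x, ‖g k x‖ ≤ 1 := fun k x => by
    rw [Real.norm_of_nonneg χ.nonneg]; exact χ.le_one
  have hgd : ∀ k x, ‖fderiv ℝ (g k) x‖ ≤ M := fun k x => by
    have h1 : HasFDerivAt (g k) ((fderiv ℝ χ (c k • x)).comp
        (c k • ContinuousLinearMap.id ℝ (EuclideanSpace ℝ ι))) x :=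
      ((hχ.differentiable (by simp)) (c k • x)).hasFDerivAt.comp x
        ((hasFDerivAt_id x).const_smul (c k))
    rw [h1.fderiv, ContinuousLinearMap.comp_smul, ContinuousLinearMap.comp_id, norm_smul,
      Real.norm_of_nonneg (hc0 k).le]
    calc c k * _ ≤ 1 * M := mul_le_mul (hc1 k) (hM _) (norm_nonneg _) zero_le_one
      _ = M := one_mul _
  have hlim : ∀ x, Filter.Tendsto (fun k => g k x * ‖ψ x‖ ^ 2) Filter.atTop
      (nhds (‖ψ x‖ ^ 2)) := fun x => by
    have h1 : Filter.Tendsto c Filter.atTop (nhds 0) :=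
      tendsto_one_div_add_atTop_nhds_zero_nat.congr fun k => by simp [c]
    have h2 : Filter.Tendsto (fun k => g k x) Filter.atTop (nhds 1) := by
      have h3 : Filter.Tendsto (fun k => c k • x) Filter.atTop (nhds 0) := by
        simpa using h1.smul_const x
      have := (hχ.continuous.tendsto 0).comp h3
      rwa [χ.one_of_mem_closedBall (by simp [χ])] at this
    simpa using h2.mul_const (‖ψ x‖ ^ 2)
  refine (Lp.eLpNorm_lim_le_liminf_eLpNorm (f := fun k x => g k x * ‖ψ x‖ ^ 2)
    (fun k => ((hg k).mul hu).continuous.aestronglyMeasurable) _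
    (Filter.Eventually.of_forall hlim)).trans ?_
  refine Filter.liminf_le_of_le (by isBoundedDefault) fun b hb => ?_
  obtain ⟨k, hk⟩ := hb.exists
  refine hk.trans ((hK _ ((hg k).mul hu) ((hgc k).mul_right)).trans ?_)
  rw [ENNReal.coe_mul, mul_assoc]
  gcongr
  rw [eLpNorm_one_eq_lintegral_enorm, ← lintegral_const_mul' _ _ (by simp)]
  refine lintegral_mono fun x => ?_
  have hdu : HasFDerivAt (fun x => ‖ψ x‖ ^ 2) (2 • (innerSL ℝ (ψ x)).comp (fderiv ℝ ψ x)) x :=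
    (ψ.differentiableAt.hasFDerivAt).norm_sq
  have hd := (((hg k).differentiable (by simp)) x).hasFDerivAt.mul hdu
  have e1 : fderiv ℝ (fun x => g k x * ‖ψ x‖ ^ 2) x = _ := hd.fderiv
  show ‖fderiv ℝ (fun x => g k x * ‖ψ x‖ ^ 2) x‖ₑ ≤ _
  rw [e1, ← ofReal_norm]
  have e2 : ((Real.toNNReal (1 + M) : ℝ≥0) : ℝ≥0∞) = ENNReal.ofReal (1 + M) := rfl
  rw [e2, ← ENNReal.ofReal_mul (by positivity)]
  apply ENNReal.ofReal_le_ofReal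
  have b1 : ‖(2 • (innerSL ℝ (ψ x)).comp (fderiv ℝ ψ x))‖ ≤ 2 * (‖ψ x‖ * ‖fderiv ℝ ψ x‖) := by
    have b0 : ‖(innerSL ℝ (ψ x)).comp (fderiv ℝ ψ x)‖ ≤ ‖ψ x‖ * ‖fderiv ℝ ψ x‖ := by
      refine (ContinuousLinearMap.opNorm_comp_le _ _).trans ?_
      rw [innerSL_apply_norm]
    rw [two_nsmul, two_mul]
    exact (norm_add_le _ _).trans (add_le_add b0 b0)
  refine (norm_add_le _ _).trans ?_
  rw [norm_smul (g k x), norm_smul (‖ψ x‖ ^ 2)]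
  have b2 := hg1 k x
  have b3 := hgd k x
  have b4 : ‖g k x‖ * ‖(2 • (innerSL ℝ (ψ x)).comp (fderiv ℝ ψ x))‖ ≤
    1 * (2 * (‖ψ x‖ * ‖fderiv ℝ ψ x‖)) := mul_le_mul b2 b1 (norm_nonneg _) zero_le_one
  have b5 : ‖(‖ψ x‖ ^ 2)‖ * ‖fderiv ℝ (g k) x‖ ≤ ‖ψ x‖ ^ 2 * M := by
    rw [Real.norm_of_nonneg (by positivity)]; gcongr
  nlinarith [sq_nonneg (‖ψ x‖ - ‖fderiv ℝ ψ x‖), mul_nonneg hM0 (sq_nonneg ‖fderiv ℝ ψ x‖)]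

theorem schwartz_sq_int {ι : Type*} [Fintype ι] (f : SchwartzMap (EuclideanSpace ℝ ι) ℂ) :
    Integrable (fun x => ‖f x‖ ^ 2) :=
  (memLp_two_iff_integrable_sq_norm f.continuous.aestronglyMeasurable).1 (f.memLp 2)

theorem weight_int {ι : Type*} [Fintype ι] (f : SchwartzMap (EuclideanSpace ℝ ι) ℂ) (k : ℕ) :
    Integrable (fun x => (1 + ‖x‖ ^ 2) ^ k * ‖f x‖ ^ 2) := by
  obtain ⟨B, hB⟩ : ∃ B, ∀ x, ‖f x‖ ≤ B := by
    obtain ⟨B, hB⟩ := f.decay 0 0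
    exact ⟨B, fun x => by simpa using hB.2 x⟩
  have h0 := f.integrable_pow_mul volume 0
  have hk := f.integrable_pow_mul volume (2 * k)
  refine (((h0.add hk).const_mul (2 ^ (k - 1) * B))).mono' (by
    apply Continuous.aestronglyMeasurable
    have := f.continuous
    fun_prop) (Filter.Eventually.of_forall fun x => ?_)
  rw [Real.norm_of_nonneg (by positivity)]
  have h1 : (1 + ‖x‖ ^ 2) ^ k ≤ 2 ^ (k - 1) * (1 ^ k + (‖x‖ ^ 2) ^ k) :=
    add_pow_le zero_le_one (by positivity) k
  have h2 : ‖f x‖ ^ 2 ≤ B * ‖f x‖ := by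
    rw [sq]; exact mul_le_mul_of_nonneg_right (hB x) (norm_nonneg _)
  calc _ ≤ (2 ^ (k - 1) * (1 ^ k + (‖x‖ ^ 2) ^ k)) * (B * ‖f x‖) := by gcongr
    _ = _ := by simp [pow_mul]; ring

theorem fourier_aux {ι : Type*} [Fintype ι] [DecidableEq ι] 
    (ψ : SchwartzMap (EuclideanSpace ℝ ι) ℂ) (i : ι) :
    ∫ x, ‖fderiv ℝ ψ x (EuclideanSpace.single i 1)‖ ^ 2 =
      (2 * Real.pi) ^ 2 * ∫ ξ : EuclideanSpace ℝ ι, (ξ i) ^ 2 * ‖𝓕 (⇑ψ) ξ‖ ^ 2 := by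
  have h := SchwartzMap.integral_norm_sq_fourier (∂_{EuclideanSpace.single i (1 : ℝ)} ψ)
  have e : ∀ x, (∂_{EuclideanSpace.single i (1 : ℝ)} ψ) x
    = fderiv ℝ ψ x (EuclideanSpace.single i 1) := fun x => rfl
  simp only [e] at h
  rw [← h, ← integral_const_mul]
  congr 1
  ext ξ
  rw [SchwartzMap.fourier_lineDerivOp_eq]
  have ht : (fun x : EuclideanSpace ℝ ι => inner ℝ x (EuclideanSpace.single i (1:ℝ))).HasTemperateGrowth :=
    ((innerSL ℝ).flip (EuclideanSpace.single i (1:ℝ))).hasTemperateGrowth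
  rw [smul_apply, SchwartzMap.smulLeftCLM_apply_apply ht, norm_smul, norm_smul,
    SchwartzMap.fourier_coe]
  have : ‖(2 * Real.pi * Complex.I : ℂ)‖ = 2 * Real.pi := by
    simp [abs_of_pos Real.pi_pos]
  rw [this, EuclideanSpace.inner_single_right]
  simp [mul_pow]
  

theorem opnorm_aux {ι : Type*} [Fintype ι] [DecidableEq ι] (L : EuclideanSpace ℝ ι →L[ℝ] ℂ) :
    ‖L‖ ^ 2 ≤ Fintype.card ι * ∑ i, ‖L (EuclideanSpace.single i 1)‖ ^ 2 := by
  have h : ‖L‖ ≤ ∑ i, ‖L (EuclideanSpace.single i 1)‖ := by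
    refine L.opNorm_le_bound (Finset.sum_nonneg fun _ _ => norm_nonneg _) fun x => ?_
    have hx : L x = ∑ i, x i • L (EuclideanSpace.single i 1) := by
      conv_lhs => rw [← (EuclideanSpace.basisFun ι ℝ).sum_repr x]
      simp
    rw [hx, Finset.sum_mul]
    refine (norm_sum_le _ _).trans (Finset.sum_le_sum fun i _ => ?_)
    rw [norm_smul, mul_comm]
    gcongr
    exact PiLp.norm_apply_le x i
  calc ‖L‖ ^ 2 ≤ (∑ i, ‖L (EuclideanSpace.single i 1)‖) ^ 2 := by gcongr
    _ ≤ _ := by simpa using sq_sum_le_card_mul_sum_sq (s := Finset.univ) (f := fun i => ‖L (EuclideanSpace.single i 1)‖)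

theorem h1_aux {ι : Type*} [Fintype ι] :
    ∃ C : ℝ≥0, ∀ (ψ : SchwartzMap (EuclideanSpace ℝ ι) ℂ) ,
      ∫⁻ x, ENNReal.ofReal (‖ψ x‖ ^ 2 + ‖fderiv ℝ ψ x‖ ^ 2) ≤
        C * ENNReal.ofReal (∫ ξ : EuclideanSpace ℝ ι, (1 + ‖ξ‖ ^ 2) * ‖𝓕 (⇑ψ) ξ‖ ^ 2) := by
  classical
  have hN : (0:ℝ) ≤ 1 + Fintype.card ι * (2 * Real.pi) ^ 2 := by positivity
  refine ⟨Real.toNNReal (1 + Fintype.card ι * (2 * Real.pi) ^ 2), fun ψ => ?_⟩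
  have e2 : ((Real.toNNReal (1 + Fintype.card ι * (2 * Real.pi) ^ 2) : ℝ≥0) : ℝ≥0∞) =
    ENNReal.ofReal (1 + Fintype.card ι * (2 * Real.pi) ^ 2) := rfl
  rw [e2, ← ENNReal.ofReal_mul hN]
  have i1 := schwartz_sq_int ψ
  have i2 : ∀ i, Integrable (fun x => ‖fderiv ℝ ψ x (EuclideanSpace.single i 1)‖ ^ 2) := fun i =>
    schwartz_sq_int (∂_{EuclideanSpace.single i (1 : ℝ)} ψ)
  have i3 : Integrable (fun x => Fintype.card ι *
      ∑ i, ‖fderiv ℝ ψ x (EuclideanSpace.single i 1)‖ ^ 2) :=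
    (integrable_finsetSum _ fun i _ => i2 i).const_mul _
  have j0 : Integrable (fun ξ => ‖𝓕 (⇑ψ) ξ‖ ^ 2) := schwartz_sq_int (𝓕 ψ)
  have j1 : Integrable (fun ξ : EuclideanSpace ℝ ι => (1 + ‖ξ‖ ^ 2) * ‖𝓕 (⇑ψ) ξ‖ ^ 2) := by
    simpa [SchwartzMap.fourier_coe] using weight_int (𝓕 ψ) 1
  have j2 : ∀ i, Integrable (fun ξ : EuclideanSpace ℝ ι => (ξ i) ^ 2 * ‖𝓕 (⇑ψ) ξ‖ ^ 2) := fun i => by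
    refine j1.mono' ?_ (Filter.Eventually.of_forall fun ξ => ?_)
    · apply Continuous.aestronglyMeasurable
      have : Continuous (𝓕 (⇑ψ)) := (𝓕 ψ).continuous
      fun_prop
    · rw [Real.norm_of_nonneg (by positivity)]
      gcongr
      have := PiLp.norm_apply_le ξ i
      have h2 : (ξ i) ^ 2 ≤ ‖ξ‖ ^ 2 := by
        rw [← sq_abs, ← Real.norm_eq_abs]; gcongr
      linarith
  calc _ ≤ ∫⁻ x, ENNReal.ofReal (‖ψ x‖ ^ 2 + Fintype.card ι *
      ∑ i, ‖fderiv ℝ ψ x (EuclideanSpace.single i 1)‖ ^ 2) := by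
        refine lintegral_mono fun x => ENNReal.ofReal_le_ofReal ?_
        gcongr
        exact opnorm_aux _
    _ = ENNReal.ofReal (∫ x, (‖ψ x‖ ^ 2 + Fintype.card ι *
      ∑ i, ‖fderiv ℝ ψ x (EuclideanSpace.single i 1)‖ ^ 2)) := by
        exact (ofReal_integral_eq_lintegral_ofReal (i1.add i3)
          (Filter.Eventually.of_forall fun x => by
            simp only [Pi.add_apply, Pi.zero_apply]; positivity)).symm
    _ ≤ _ := by
        apply ENNReal.ofReal_le_ofReal
        rw [integral_add i1 i3, integral_const_mul, integral_finsetSum _ fun i _ => i2 i]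
        simp_rw [fourier_aux]
        rw [← Finset.mul_sum, ← integral_finsetSum _ fun i _ => j2 i]
        have k1 : ∫ x, ‖ψ x‖ ^ 2 = ∫ ξ, ‖𝓕 (⇑ψ) ξ‖ ^ 2 :=
          (SchwartzMap.integral_norm_sq_fourier ψ).symm
        have k2 : ∫ ξ, ‖𝓕 (⇑ψ) ξ‖ ^ 2 ≤
            ∫ ξ : EuclideanSpace ℝ ι, (1 + ‖ξ‖ ^ 2) * ‖𝓕 (⇑ψ) ξ‖ ^ 2 :=
          integral_mono j0 j1 fun ξ => by
            show _ ≤ (1 + ‖ξ‖ ^ 2) * ‖𝓕 (⇑ψ) ξ‖ ^ 2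
            nlinarith [mul_nonneg (sq_nonneg ‖ξ‖) (sq_nonneg ‖𝓕 (⇑ψ) ξ‖)]
        have k3 : ∫ ξ : EuclideanSpace ℝ ι, ∑ i, (ξ i) ^ 2 * ‖𝓕 (⇑ψ) ξ‖ ^ 2 ≤
            ∫ ξ : EuclideanSpace ℝ ι, (1 + ‖ξ‖ ^ 2) * ‖𝓕 (⇑ψ) ξ‖ ^ 2 :=
          integral_mono (integrable_finsetSum _ fun i _ => j2 i) j1 fun ξ => by
            show _ ≤ (1 + ‖ξ‖ ^ 2) * ‖𝓕 (⇑ψ) ξ‖ ^ 2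
            rw [EuclideanSpace.real_norm_sq_eq]
            rw [← Finset.sum_mul]
            gcongr
            linarith
        rw [k1, add_mul, one_mul, ← mul_assoc]
        gcongr

theorem holder_aux {α : Type*} [MeasurableSpace α] {μ : Measure α} (n : ℕ) (hn : 1 ≤ n) (r : ℝ)
    (hr : (n : ℝ) ≤ r) (p : ℝ≥0∞) (hp : ENNReal.HolderConjugate (n : ℝ≥0∞) p) (V u : α → ℝ)
    (hV : MemLp V (ENNReal.ofReal r) μ) (hu : AEStronglyMeasurable u μ) :
    ∫⁻ x, ‖V x * u x‖ₑ ∂μ ≤ eLpNorm V (ENNReal.ofReal r) μ *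
      (eLpNorm u 1 μ + eLpNorm u p μ) := by
  set T := eLpNorm V (ENNReal.ofReal r) μ with hT
  have hn0 : (0:ℝ) < n := by exact_mod_cast hn
  have hr0 : 0 < r := hn0.trans_le hr
  have hTtop : T ≠ ⊤ := hV.2.ne
  by_cases hT0 : T = 0
  · rw [hT0, zero_mul, nonpos_iff_eq_zero]
    have : V =ᵐ[μ] 0 := (eLpNorm_eq_zero_iff hV.1 (by simpa using hr0)).1 hT0
    rw [lintegral_congr_ae (g := fun _ => 0), lintegral_zero]
    filter_upwards [this] with x hx
    simp [hx]
  set s := r / n with hs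
  have hs1 : 1 ≤ s := (one_le_div hn0).2 hr
  have hs0 : 0 < s := by linarith
  have key : ∀ a : ℝ≥0∞, a ≤ T + a ^ s * T ^ (1 - s) := fun a => by
    rcases le_total a T with h | h
    · exact h.trans le_self_add
    · refine le_trans ?_ le_add_self
      calc a = a * T ^ (s - 1) * T ^ (1 - s) := by
            rw [mul_assoc, ← ENNReal.rpow_add _ _ hT0 hTtop]; simp
        _ ≤ a * a ^ (s - 1) * T ^ (1 - s) := by
            gcongr
        _ = _ := by
            congr 1
            conv_lhs => rw [← ENNReal.rpow_one a]
            rw [← ENNReal.rpow_mul, one_mul,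
              ← ENNReal.rpow_add_of_nonneg _ _ zero_le_one (by linarith)]
            congr 1; ring
  have hVs : AEStronglyMeasurable (fun x => ‖V x‖ ^ s) μ :=
    (hV.1.norm.aemeasurable.pow_const s).aestronglyMeasurable
  have hH : ∫⁻ x, ‖V x‖ₑ ^ s * ‖u x‖ₑ ∂μ ≤ T ^ s * eLpNorm u p μ := by
    have := eLpNorm_smul_le_mul_eLpNorm (r := 1) hu hVs (hpqr := hp)
    rw [eLpNorm_norm_rpow _ hs0, eLpNorm_one_eq_lintegral_enorm] at this
    have e : (n : ℝ≥0∞) * ENNReal.ofReal s = ENNReal.ofReal r := by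
      rw [← ENNReal.ofReal_natCast, ← ENNReal.ofReal_mul hn0.le, hs, mul_div_cancel₀ _ hn0.ne']
    rw [e] at this
    refine le_trans (le_of_eq (lintegral_congr fun x => ?_)) this
    simp only [Pi.smul_apply', smul_eq_mul, enorm_mul]
    rw [Real.enorm_rpow_of_nonneg (norm_nonneg _) hs0.le, enorm_norm]
  have hum : AEMeasurable (fun x => ‖u x‖ₑ) μ := hu.enorm
  calc ∫⁻ x, ‖V x * u x‖ₑ ∂μ
      ≤ ∫⁻ x, (T * ‖u x‖ₑ + T ^ (1 - s) * (‖V x‖ₑ ^ s * ‖u x‖ₑ)) ∂μ := by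
        refine lintegral_mono fun x => ?_
        rw [enorm_mul]
        calc _ ≤ (T + ‖V x‖ₑ ^ s * T ^ (1 - s)) * ‖u x‖ₑ := by gcongr; exact key _
          _ = _ := by ring
    _ = T * eLpNorm u 1 μ + T ^ (1 - s) * ∫⁻ x, ‖V x‖ₑ ^ s * ‖u x‖ₑ ∂μ := by
        rw [lintegral_add_left' (hum.const_mul _), lintegral_const_mul' _ _ hTtop,
          lintegral_const_mul' _ _ (ENNReal.rpow_ne_top_of_ne_zero hT0 hTtop), eLpNorm_one_eq_lintegral_enorm]
    _ ≤ T * eLpNorm u 1 μ + T ^ (1 - s) * (T ^ s * eLpNorm u p μ) := by gcongr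
    _ = _ := by
        rw [← mul_assoc, ← ENNReal.rpow_add _ _ hT0 hTtop, mul_add]; simp

theorem prod_aux {d m : ℕ} (ξ : EuclideanSpace ℝ (Fin m × Fin d)) :
    1 + ‖ξ‖ ^ 2 ≤ ∏ j : Fin m, (1 + ∑ i : Fin d, (ξ (j, i)) ^ 2) := by
  rw [EuclideanSpace.real_norm_sq_eq, Fintype.sum_prod_type]
  induction (Finset.univ : Finset (Fin m)) using Finset.induction_on with
  | empty => simp
  | insert a s ha ih =>
    rw [Finset.sum_insert ha, Finset.prod_insert ha]
    have h1 : 0 ≤ ∑ i : Fin d, (ξ (a, i)) ^ 2 := by positivity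
    have h2 : 0 ≤ ∑ j ∈ s, ∑ i : Fin d, (ξ (j, i)) ^ 2 := by positivity
    nlinarith [mul_le_mul_of_nonneg_left ih (add_nonneg zero_le_one h1), mul_nonneg h1 h2]

theorem prod_aux2 {d m : ℕ} (ξ : EuclideanSpace ℝ (Fin m × Fin d)) :
    ∏ j : Fin m, (1 + ∑ i : Fin d, (ξ (j, i)) ^ 2) ≤ (1 + ‖ξ‖ ^ 2) ^ m := by
  calc _ ≤ ∏ j : Fin m, (1 + ‖ξ‖ ^ 2) := by
        refine Finset.prod_le_prod (fun j _ => by positivity) fun j _ => ?_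
        rw [EuclideanSpace.real_norm_sq_eq, Fintype.sum_prod_type]
        gcongr
        exact Finset.single_le_sum (f := fun j => ∑ i : Fin d, (ξ (j, i)) ^ 2)
          (fun j _ => Finset.sum_nonneg fun i _ => sq_nonneg _) (Finset.mem_univ j)
    _ = _ := by simp

/-- Lemma 2.2, first part: a Sobolev/Hölder-type bound.
For `d, m ≥ 1` and a real exponent `r` with `r > 2` when `m·d ≤ 2` and `r ≥ m·d` when
`m·d > 2`, there is a constant `C > 0` such that for every `V ∈ L^r(ℝ^{md})` (real valued)
and every Schwartz function `ψ` on `ℝ^{md}` (variables grouped into `m` blocks in `ℝ^d`),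
`|∫ V |ψ|²| ≤ C ‖V‖_{L^r} ∫ ∏_{j=1}^m (1+|ξ_j|²) |ψ̂(ξ)|² dξ`. -/
theorem sobolev_holder_bound
    (d m : ℕ) (hd : 1 ≤ d) (hm : 1 ≤ m) (r : ℝ)
    (hr_low : m * d ≤ 2 → 2 < r)
    (hr_high : 2 < m * d → (m * d : ℝ) ≤ r) :
    ∃ C : ℝ, 0 < C ∧
      ∀ (V : EuclideanSpace ℝ (Fin m × Fin d) → ℝ),
        MemLp V (ENNReal.ofReal r) →
        ∀ ψ : SchwartzMap (EuclideanSpace ℝ (Fin m × Fin d)) ℂ,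
          |∫ x, V x * ‖ψ x‖ ^ 2| ≤
            C * (eLpNorm V (ENNReal.ofReal r) volume).toReal *
              ∫ ξ : EuclideanSpace ℝ (Fin m × Fin d),
                (∏ j : Fin m, (1 + ∑ i : Fin d, (ξ (j, i)) ^ 2)) * ‖𝓕 (⇑ψ) ξ‖ ^ 2 := by
  have : Nonempty (Fin m × Fin d) := ⟨(⟨0, hm⟩, ⟨0, hd⟩)⟩
  obtain ⟨p, hp, K, hK⟩ := sob_aux (ι := Fin m × Fin d)
  obtain ⟨C, hC⟩ := h1_aux (ι := Fin m × Fin d)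
  have hcard : Fintype.card (Fin m × Fin d) = m * d := by simp
  rw [hcard] at hp
  have hn : 1 ≤ m * d := Nat.mul_pos hm hd
  have hr : ((m * d : ℕ) : ℝ) ≤ r := by
    rcases Nat.lt_or_ge 2 (m * d) with h | h
    · simpa using hr_high h
    · have h1 := hr_low h
      have h2 : ((m * d : ℕ) : ℝ) ≤ 2 := by exact_mod_cast h
      linarith
  refine ⟨((1 + K) * C + 1 : ℝ≥0), by positivity, fun V hV ψ => ?_⟩
  set J := ∫ ξ : EuclideanSpace ℝ (Fin m × Fin d),
    (∏ j : Fin m, (1 + ∑ i : Fin d, (ξ (j, i)) ^ 2)) * ‖𝓕 (⇑ψ) ξ‖ ^ 2 with hJ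
  have hJ0 : 0 ≤ J := integral_nonneg fun ξ => by positivity
  set S := ∫⁻ x, ENNReal.ofReal (‖ψ x‖ ^ 2 + ‖fderiv ℝ ψ x‖ ^ 2) with hS
  have hFc : Continuous (𝓕 (⇑ψ)) := (𝓕 ψ).continuous
  have hSJ : S ≤ C * ENNReal.ofReal J := by
    refine (hC ψ).trans ?_
    gcongr
    have j1 := weight_int (𝓕 ψ) m
    have j2 : Integrable (fun ξ : EuclideanSpace ℝ (Fin m × Fin d) =>
        (∏ j : Fin m, (1 + ∑ i : Fin d, (ξ (j, i)) ^ 2)) * ‖𝓕 (⇑ψ) ξ‖ ^ 2) := by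
      refine j1.mono' (Continuous.aestronglyMeasurable (by fun_prop))
        (Filter.Eventually.of_forall fun ξ => ?_)
      rw [Real.norm_of_nonneg (by positivity), SchwartzMap.fourier_coe]
      gcongr
      exact prod_aux2 ξ
    refine integral_mono_of_nonneg (Filter.Eventually.of_forall fun ξ => by positivity) j2
      (Filter.Eventually.of_forall fun ξ => ?_)
    exact mul_le_mul_of_nonneg_right (prod_aux ξ) (by positivity)
  have h1 : eLpNorm (fun x => ‖ψ x‖ ^ 2) 1 volume ≤ S := by
    rw [eLpNorm_one_eq_lintegral_enorm]
    refine lintegral_mono fun x => ?_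
    rw [← ofReal_norm, Real.norm_of_nonneg (by positivity)]
    apply ENNReal.ofReal_le_ofReal
    linarith [sq_nonneg ‖fderiv ℝ ψ x‖]
  have hH := holder_aux (μ := volume) (m * d) hn r hr p hp V (fun x => ‖ψ x‖ ^ 2) hV
    (ψ.continuous.norm.pow 2).aestronglyMeasurable
  have hTtop := hV.2.ne
  set T := eLpNorm V (ENNReal.ofReal r) volume with hT
  have hfin : ∫⁻ x, ‖V x * ‖ψ x‖ ^ 2‖ₑ ≤
      T * (((1 + K) * C + 1 : ℝ≥0) * ENNReal.ofReal J) := by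
    refine hH.trans ?_
    gcongr
    calc _ ≤ S + K * S := add_le_add h1 (hK ψ)
      _ = (1 + K) * S := by ring
      _ ≤ (1 + K) * (C * ENNReal.ofReal J) := by gcongr
      _ = ((1 + K) * C) * ENNReal.ofReal J := by ring
      _ ≤ _ := by
        gcongr
        push_cast
        exact le_self_add
  have hfin2 := (enorm_integral_le_lintegral_enorm (μ := volume)
    (fun x => V x * ‖ψ x‖ ^ 2)).trans hfin
  have hne : T * (((1 + K) * C + 1 : ℝ≥0) * ENNReal.ofReal J) ≠ ⊤ :=
    ENNReal.mul_ne_top hTtop (ENNReal.mul_ne_top ENNReal.coe_ne_top ENNReal.ofReal_ne_top)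
  have h3 := ENNReal.toReal_mono hne hfin2
  rw [toReal_enorm, Real.norm_eq_abs, ENNReal.toReal_mul, ENNReal.toReal_mul,
    ENNReal.coe_toReal, ENNReal.toReal_ofReal hJ0] at h3
  calc _ ≤ _ := h3
    _ = _ := by ring
end

section
/- Let d ∈ {1, 2}, let k ≥ 1, p ≥ 1 be integers, let 1 ≤ j ≤ k, and let α ≥ 0 satisfy α < 1 if d = 2 and α ≤ 1 if d = 1. Then there exists a constant C_α > 0, depending only on α, d, p (and in particular independent of k, j, and the data below), with the following property: for every finite integer M ≥ 1, every choice of nonnegative reals λ₁, …, λ_M, and every choice of Schwartz functions f₁, …, f_M on ℝ^{d(k+p)}, if γ denotes the kernel γ(x; x') = Σ_{i=1}^{M} λ_i f_i(x) · conj(f_i(x')) on ℝ^{d(k+p)} × ℝ^{d(k+p)}, then ‖S^{(k,α)} B_{j;k+1,…,k+p} γ‖_{L²(ℝ^{dk} × ℝ^{dk})} ≤ C_α · Σ_{i=1}^{M} λ_i ∫_{ℝ^{d(k+p)}} ∏_{l=1}^{k+p} (1 + |ξ_l|²) |f̂_i(ξ₁, …, ξ_{k+p})|² dξ. -/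
open MeasureTheory
open scoped FourierTransform ENNReal

/-- Interpret a plain function on the index set as a point of the corresponding
Euclidean space (they are definitionally equal). -/
noncomputable def toEuc (ι : Type*) [Fintype ι] (g : ι → ℝ) : EuclideanSpace ℝ ι := WithLp.toLp 2 g

/-- The pair space `ℝ^{dn} × ℝ^{dn}`, realized as one Euclidean space: the `Sum.inl`
indices are the unprimed variables `(x₁,…,x_n)` and the `Sum.inr` indices the primed
variables `(x'₁,…,x'_n)`; each `x_l ∈ ℝ^d` occupies the indices `(l, i)`, `i : Fin d`. -/
abbrev PairSpace (d n : ℕ) :=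
  EuclideanSpace ℝ ((Fin n × Fin d) ⊕ (Fin n × Fin d))

/-- The contraction operator `B_{j;k+1,…,k+p}`: given a kernel
`γ(x₁,…,x_{k+p}; x'₁,…,x'_{k+p})`, it produces the kernel of `(x₁,…,x_k; x'₁,…,x'_k)` given by
`γ(x₁,…,x_k,x_j,…,x_j; x'₁,…,x'_k,x_j,…,x_j) − γ(x₁,…,x_k,x'_j,…,x'_j; x'₁,…,x'_k,x'_j,…,x'_j)`,
where the last `p` entries of each slot are all set to `x_j` (resp. `x'_j`). -/
noncomputable def contractB (d k p : ℕ) (j : Fin k)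
    (γ : PairSpace d (k + p) → ℂ) (z : PairSpace d k) : ℂ :=
  let x : Fin k → Fin d → ℝ := fun l i => z (Sum.inl (l, i))
  let x' : Fin k → Fin d → ℝ := fun l i => z (Sum.inr (l, i))
  let ext : (Fin k → Fin d → ℝ) → (Fin d → ℝ) → (Fin (k + p) × Fin d) → ℝ :=
    fun w y q => if h : (q.1 : ℕ) < k then w ⟨q.1, h⟩ q.2 else y q.2
  γ (toEuc _ (Sum.elim (ext x (x j)) (ext x' (x j)))) -
    γ (toEuc _ (Sum.elim (ext x (x' j)) (ext x' (x' j))))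

/-- The symbol of the Fourier multiplier `S^{(n,α)}`:
`∏_{l=1}^n ⟨ξ_l⟩^α ⟨ξ'_l⟩^α` with `⟨ξ⟩ = (1+|ξ|²)^{1/2}`. -/
noncomputable def weightS (d n : ℕ) (α : ℝ) (ζ : PairSpace d n) : ℝ :=
  ∏ l : Fin n,
    ((1 + ∑ i : Fin d, (ζ (Sum.inl (l, i))) ^ 2) ^ (α / 2) *
      (1 + ∑ i : Fin d, (ζ (Sum.inr (l, i))) ^ 2) ^ (α / 2))


noncomputable def jb {d : ℕ} (v : Fin d → ℝ) : ℝ := 1 + ∑ i, v i ^ 2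

lemma one_le_jb {d : ℕ} (v : Fin d → ℝ) : 1 ≤ jb v := by
  unfold jb
  have : 0 ≤ ∑ i, v i ^ 2 := Finset.sum_nonneg fun i _ => sq_nonneg _
  linarith

lemma jb_pos {d : ℕ} (v : Fin d → ℝ) : 0 < jb v := lt_of_lt_of_le one_pos (one_le_jb v)

lemma continuous_jb {d : ℕ} : Continuous (jb (d := d)) := by
  unfold jb; fun_prop

lemma jb_le {d : ℕ} (x y : Fin d → ℝ) : jb x ≤ 2 * (jb (x - y) + jb y) := by
  unfold jb
  have h : ∑ i, x i ^ 2 ≤ ∑ i, (2 * (x - y) i ^ 2 + 2 * y i ^ 2) := by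
    apply Finset.sum_le_sum
    intro i _
    simp only [Pi.sub_apply]
    nlinarith [sq_nonneg (x i - 2 * y i)]
  rw [Finset.sum_add_distrib, ← Finset.mul_sum, ← Finset.mul_sum] at h
  linarith

noncomputable def jw {d : ℕ} (s : ℝ) (v : Fin d → ℝ) : ℝ≥0∞ := ENNReal.ofReal (jb v ^ (-s))

lemma continuous_jbpow {d : ℕ} (s : ℝ) : Continuous (fun v : Fin d → ℝ => jb v ^ s) :=
  continuous_jb.rpow_const fun v => Or.inl (jb_pos v).ne'

lemma measurable_jw {d : ℕ} (s : ℝ) : Measurable (jw (d := d) s) :=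
  (ENNReal.continuous_ofReal.comp (continuous_jbpow (-s))).measurable

lemma jw_antitone {d : ℕ} {s t : ℝ} (h : s ≤ t) (v : Fin d → ℝ) : jw t v ≤ jw s v := by
  unfold jw
  exact ENNReal.ofReal_le_ofReal (Real.rpow_le_rpow_of_exponent_le (one_le_jb v) (by linarith))

lemma lintegral_jw_ne_top {d : ℕ} {s : ℝ} (h : (d : ℝ) < 2 * s) :
    ∫⁻ v : Fin d → ℝ, jw s v ≠ ⊤ := by
  have h1 : Integrable (fun x : EuclideanSpace ℝ (Fin d) => (1 + ‖x‖ ^ 2) ^ (-(2 * s) / 2)) :=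
    integrable_rpow_neg_one_add_norm_sq (by simpa using h)
  have h2 := (PiLp.volume_preserving_toLp (Fin d)).integrable_comp_of_integrable h1
  have h3 := h2.lintegral_lt_top
  refine ne_of_lt (lt_of_le_of_lt (le_of_eq ?_) h3)
  congr 1
  ext v
  unfold jw jb
  simp only [Function.comp, EuclideanSpace.norm_sq_eq, Real.norm_eq_abs, sq_abs]
  congr 2
  ring

lemma real_ptwise {u v w β β' : ℝ} (hu : 1 ≤ u) (hv : 1 ≤ v) (hw : 1 ≤ w)
    (hwuv : w ≤ 2 * (u + v)) (h0 : 0 ≤ β') (hb : β' ≤ β) (h1 : β ≤ 1) :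
    u ^ (-β) * v ^ (-(1:ℝ)) ≤
      4 ^ β' * (w ^ (-β') * (u ^ (-(1 + β - β')) + v ^ (-(1 + β - β')))) := by
  have hu0 : 0 < u := by linarith
  have hv0 : 0 < v := by linarith
  have hw0 : 0 < w := by linarith
  have key : w ^ β' * (u ^ (-β) * v ^ (-(1:ℝ))) ≤
      4 ^ β' * (u ^ (-(1 + β - β')) + v ^ (-(1 + β - β'))) := by
    rcases le_total u v with h | h
    · calc w ^ β' * (u ^ (-β) * v ^ (-(1:ℝ)))
          ≤ (4 * v) ^ β' * (u ^ (-β) * v ^ (-(1:ℝ))) := by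
            gcongr; linarith
        _ = 4 ^ β' * (u ^ (-β) * v ^ (β' - 1)) := by
            rw [Real.mul_rpow (by norm_num) hv0.le, sub_eq_add_neg, Real.rpow_add hv0]; ring
        _ ≤ 4 ^ β' * (u ^ (-β) * u ^ (β' - 1)) := by
            gcongr ?_ * (?_ * ?_)
            exact Real.rpow_le_rpow_of_nonpos hu0 h (by linarith)
        _ = 4 ^ β' * u ^ (-(1 + β - β')) := by
            rw [← Real.rpow_add hu0]; congr 2; ring
        _ ≤ _ := by
            gcongr
            have := Real.rpow_pos_of_pos hv0 (-(1 + β - β'))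
            linarith
    · calc w ^ β' * (u ^ (-β) * v ^ (-(1:ℝ)))
          ≤ (4 * u) ^ β' * (u ^ (-β) * v ^ (-(1:ℝ))) := by
            gcongr; linarith
        _ = 4 ^ β' * (u ^ (β' - β) * v ^ (-(1:ℝ))) := by
            rw [Real.mul_rpow (by norm_num) hu0.le, sub_eq_add_neg, Real.rpow_add hu0]; ring
        _ ≤ 4 ^ β' * (v ^ (β' - β) * v ^ (-(1:ℝ))) := by
            gcongr ?_ * (?_ * ?_)
            exact Real.rpow_le_rpow_of_nonpos hv0 h (by linarith)
        _ = 4 ^ β' * v ^ (-(1 + β - β')) := by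
            rw [← Real.rpow_add hv0]; congr 2; ring
        _ ≤ _ := by
            gcongr
            have := Real.rpow_pos_of_pos hu0 (-(1 + β - β'))
            linarith
  have hp := Real.rpow_pos_of_pos hw0 β'
  rw [Real.rpow_neg hw0.le]
  calc u ^ (-β) * v ^ (-(1:ℝ)) = (w ^ β')⁻¹ * (w ^ β' * (u ^ (-β) * v ^ (-(1:ℝ)))) := by
        field_simp
    _ ≤ (w ^ β')⁻¹ * (4 ^ β' * (u ^ (-(1 + β - β')) + v ^ (-(1 + β - β')))) := by gcongr
    _ = _ := by ring

lemma conv_one {d : ℕ} {β β' : ℝ} (h0 : 0 ≤ β') (hb : β' ≤ β) (h1 : β ≤ 1)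
    (hd : (d : ℝ) < 2 * (1 + β - β')) :
    ∃ C : ℝ≥0∞, C ≠ ⊤ ∧ ∀ ξ : Fin d → ℝ,
      ∫⁻ η : Fin d → ℝ, jw β (ξ - η) * jw 1 η ≤ C * jw β' ξ := by
  set s := 1 + β - β' with hs
  refine ⟨ENNReal.ofReal (4 ^ β') * ((∫⁻ v : Fin d → ℝ, jw s v) + ∫⁻ v : Fin d → ℝ, jw s v),
    ?_, ?_⟩
  · exact ENNReal.mul_ne_top ENNReal.ofReal_ne_top
      (ENNReal.add_ne_top.2 ⟨lintegral_jw_ne_top hd, lintegral_jw_ne_top hd⟩)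
  intro ξ
  have hpt : ∀ η : Fin d → ℝ, jw β (ξ - η) * jw 1 η ≤
      ENNReal.ofReal (4 ^ β') * (jw β' ξ * (jw s (ξ - η) + jw s η)) := by
    intro η
    unfold jw
    have hnn : ∀ (v : Fin d → ℝ) (t : ℝ), 0 ≤ jb v ^ t := fun v t =>
      (Real.rpow_pos_of_pos (jb_pos v) t).le
    rw [← ENNReal.ofReal_mul (hnn _ _), ← ENNReal.ofReal_add (hnn _ _) (hnn _ _),
      ← ENNReal.ofReal_mul (hnn _ _), ← ENNReal.ofReal_mul (by positivity)]
    exact ENNReal.ofReal_le_ofReal (real_ptwise (one_le_jb _) (one_le_jb _) (one_le_jb _)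
      (jb_le ξ η) h0 hb h1)
  have hm := measurable_jw (d := d) s
  calc ∫⁻ η : Fin d → ℝ, jw β (ξ - η) * jw 1 η
      ≤ ∫⁻ η : Fin d → ℝ, ENNReal.ofReal (4 ^ β') * (jw β' ξ * (jw s (ξ - η) + jw s η)) :=
        lintegral_mono hpt
    _ = ENNReal.ofReal (4 ^ β') * (jw β' ξ *
          ((∫⁻ v : Fin d → ℝ, jw s (ξ - v)) + ∫⁻ v : Fin d → ℝ, jw s v)) := by
        rw [lintegral_const_mul _ (by fun_prop), lintegral_const_mul _ (by fun_prop),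
          lintegral_add_right _ hm]
    _ = _ := by
        rw [lintegral_sub_left_eq_self (fun v => jw s v) ξ]; ring

lemma conv_many {d : ℕ} (n : ℕ) : ∀ {β β' : ℝ}, 0 ≤ β' → β' ≤ β → β ≤ 1 →
    (d < 2 ∨ (d = 2 ∧ β' < β)) →
    ∃ C : ℝ≥0∞, C ≠ ⊤ ∧ ∀ ξ : Fin d → ℝ,
      ∫⁻ η : Fin n → Fin d → ℝ, jw β (ξ - ∑ m, η m) * ∏ m, jw 1 (η m) ≤ C * jw β' ξ := by
  induction n with
  | zero =>
    intro β β' h0 hb h1 hd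
    refine ⟨1, by simp, fun ξ => ?_⟩
    simp only [Finset.univ_eq_empty, Finset.sum_empty, sub_zero, Finset.prod_empty, mul_one,
      one_mul, lintegral_const]
    have : (volume : Measure (Fin 0 → Fin d → ℝ)) Set.univ = 1 := by
      rw [volume_pi, Measure.pi_of_empty]; simp
    rw [this, mul_one]
    exact jw_antitone hb ξ
  | succ n ih =>
    intro β β' h0 hb h1 hd
    obtain ⟨C1, hC1, H1⟩ := ih (β := β) (β' := (β + β') / 2) (by linarith) (by linarith) h1
      (by rcases hd with h | h
          · exact Or.inl h
          · exact Or.inr ⟨h.1, by linarith [h.2]⟩)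
    obtain ⟨C2, hC2, H2⟩ := conv_one (d := d) (β := (β + β') / 2) (β' := β') h0 (by linarith)
      (by linarith) (by
        rcases hd with h | h
        · have : (d : ℝ) ≤ 1 := by exact_mod_cast (by omega : d ≤ 1)
          linarith
        · have : (d : ℝ) = 2 := by exact_mod_cast h.1
          linarith [h.2])
    refine ⟨C1 * C2, ENNReal.mul_ne_top hC1 hC2, fun ξ => ?_⟩
    have hj := fun s => measurable_jw (d := d) s
    have hmp := (volume_preserving_piFinSuccAbove (fun _ : Fin (n + 1) => Fin d → ℝ) 0).symm
    rw [← hmp.lintegral_comp_emb (MeasurableEquiv.measurableEmbedding _)]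
    rw [Measure.volume_eq_prod, lintegral_prod]
    swap
    · refine Measurable.aemeasurable (Measurable.comp (g := fun η : Fin (n+1) → Fin d → ℝ => jw β (ξ - ∑ m, η m) * ∏ m, jw 1 (η m)) ?_ (MeasurableEquiv.measurable _))
      fun_prop
    simp only [MeasurableEquiv.piFinSuccAbove_symm_apply, Fin.insertNthEquiv, Fin.insertNth_zero, Equiv.coe_fn_mk, Fin.sum_univ_succ, Fin.prod_univ_succ, Fin.cons_zero, Fin.cons_succ]
    calc _ ≤ ∫⁻ x : Fin d → ℝ, C1 * (jw ((β + β') / 2) (ξ - x) * jw 1 x) := by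
          apply lintegral_mono
          intro x
          have := H1 (ξ - x)
          calc _ = ∫⁻ η : Fin n → Fin d → ℝ, jw 1 x * (jw β (ξ - x - ∑ m, η m) * ∏ m, jw 1 (η m)) := by
                apply lintegral_congr; intro η
                rw [sub_sub]; simp; ring
            _ = jw 1 x * ∫⁻ η : Fin n → Fin d → ℝ, (jw β (ξ - x - ∑ m, η m) * ∏ m, jw 1 (η m)) := by
                rw [lintegral_const_mul _ (by fun_prop)]
            _ ≤ jw 1 x * (C1 * jw ((β + β') / 2) (ξ - x)) := by gcongr
            _ = _ := by ring
      _ = C1 * ∫⁻ x : Fin d → ℝ, (jw ((β + β') / 2) (ξ - x) * jw 1 x) := by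
          rw [lintegral_const_mul _ (by fun_prop)]
      _ ≤ C1 * (C2 * jw β' ξ) := by gcongr; exact H2 ξ
      _ = _ := by ring

lemma conv_two {d p : ℕ} {α : ℝ} (h0 : 0 ≤ α) (h1 : α ≤ 1)
    (hd : d < 2 ∨ (d = 2 ∧ α < 1)) :
    ∃ C : ℝ≥0∞, C ≠ ⊤ ∧ ∀ ξ : Fin d → ℝ,
      ∫⁻ η : (Fin p → Fin d → ℝ) × (Fin p → Fin d → ℝ),
        jw 1 (ξ - (∑ m, η.1 m + ∑ m, η.2 m)) * ((∏ m, jw 1 (η.1 m)) * ∏ m, jw 1 (η.2 m))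
        ≤ C * jw α ξ := by
  obtain ⟨C1, hC1, H1⟩ := conv_many (d := d) p (β := 1) (β' := (1 + α) / 2) (by linarith)
    (by linarith) le_rfl (by
      rcases hd with h | h
      · exact Or.inl h
      · exact Or.inr ⟨h.1, by linarith [h.2]⟩)
  obtain ⟨C2, hC2, H2⟩ := conv_many (d := d) p (β := (1 + α) / 2) (β' := α) (by linarith)
    (by linarith) (by linarith) (by
      rcases hd with h | h
      · exact Or.inl h
      · exact Or.inr ⟨h.1, by linarith [h.2]⟩)
  have hj := fun s => measurable_jw (d := d) s
  refine ⟨C1 * C2, ENNReal.mul_ne_top hC1 hC2, fun ξ => ?_⟩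
  rw [Measure.volume_eq_prod, lintegral_prod _ (by fun_prop)]
  calc _ ≤ ∫⁻ x : Fin p → Fin d → ℝ, C1 * (jw ((1 + α) / 2) (ξ - ∑ m, x m) * ∏ m, jw 1 (x m)) := by
        apply lintegral_mono
        intro x
        have := H1 (ξ - ∑ m, x m)
        calc _ = ∫⁻ η : Fin p → Fin d → ℝ, (∏ m, jw 1 (x m)) *
                  (jw 1 (ξ - ∑ m, x m - ∑ m, η m) * ∏ m, jw 1 (η m)) := by
              apply lintegral_congr; intro η
              rw [sub_sub]; ring
          _ = (∏ m, jw 1 (x m)) * ∫⁻ η : Fin p → Fin d → ℝ,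
                  (jw 1 (ξ - ∑ m, x m - ∑ m, η m) * ∏ m, jw 1 (η m)) := by
              rw [lintegral_const_mul _ (by fun_prop)]
          _ ≤ (∏ m, jw 1 (x m)) * (C1 * jw ((1 + α) / 2) (ξ - ∑ m, x m)) := by gcongr
          _ = _ := by ring
    _ = C1 * ∫⁻ x : Fin p → Fin d → ℝ, (jw ((1 + α) / 2) (ξ - ∑ m, x m) * ∏ m, jw 1 (x m)) := by
        rw [lintegral_const_mul _ (by fun_prop)]
    _ ≤ C1 * (C2 * jw α ξ) := by gcongr; exact H2 ξ
    _ = _ := by ring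

section Shear
variable {X Y : Type*} [MeasurableSpace X] [MeasurableSpace Y]

lemma mp_comm4 (μ : Measure X) (ν : Measure Y) [SFinite μ] [SFinite ν] :
    MeasurePreserving (fun z : (X × X) × (Y × Y) => ((z.1.1, z.2.1), (z.1.2, z.2.2)))
      ((μ.prod μ).prod (ν.prod ν)) ((μ.prod ν).prod (μ.prod ν)) := by
  have h1 := measurePreserving_prodAssoc μ μ (ν.prod ν)
  have h2 := (MeasurePreserving.id μ).prod ((measurePreserving_prodAssoc μ ν ν).symm)
  have h3 := (MeasurePreserving.id μ).prod
    ((Measure.measurePreserving_swap (μ := μ) (ν := ν)).prod (MeasurePreserving.id ν))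
  have h4 := (MeasurePreserving.id μ).prod (measurePreserving_prodAssoc ν μ ν)
  have h5 := (measurePreserving_prodAssoc μ ν (μ.prod ν)).symm
  exact h5.comp (h4.comp (h3.comp (h2.comp h1)))

lemma mp_shear [AddGroup X] [MeasurableAdd₂ X] [MeasurableNeg X] [MeasurableSub₂ X] (μ : Measure X) (ν : Measure Y)
    [SFinite μ] [SFinite ν] [μ.IsAddRightInvariant] (T : Y × Y → X) (hT : Measurable T) :
    MeasurePreserving
      (fun z : (X × X) × (Y × Y) => ((z.1.1 - T z.2, z.2.1), (z.1.2, z.2.2)))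
      ((μ.prod μ).prod (ν.prod ν)) ((μ.prod ν).prod (μ.prod ν)) := by
  have h1 := Measure.measurePreserving_swap (μ := μ.prod μ) (ν := ν.prod ν)
  have h2 := Measure.measurePreserving_swap (μ := ν.prod ν) (ν := μ.prod μ)
  have hs : MeasurePreserving
      (fun z : (Y × Y) × (X × X) => (id z.1, (fun (y : Y × Y) (x : X × X) => (x.1 - T y, x.2)) z.1 z.2))
      ((ν.prod ν).prod (μ.prod μ)) ((ν.prod ν).prod (μ.prod μ)) := by
    refine MeasurePreserving.skew_product (g := fun (y : Y × Y) (x : X × X) => (x.1 - T y, x.2))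
      (MeasurePreserving.id (ν.prod ν)) ?_ ?_
    · unfold Function.uncurry; fun_prop
    · refine Filter.Eventually.of_forall fun y => ?_
      exact ((measurePreserving_sub_right μ (T y)).prod (MeasurePreserving.id μ)).map_eq
  exact (mp_comm4 μ ν).comp (h2.comp (hs.comp h1))

end Shear

lemma cs_weight {Ω : Type*} [MeasurableSpace Ω] (μ : Measure Ω) (f q : Ω → ℝ≥0∞)
    (hf : AEMeasurable f μ) (hq : Measurable q) (h0 : ∀ x, q x ≠ 0) (ht : ∀ x, q x ≠ ⊤) :
    (∫⁻ x, f x ∂μ) ^ 2 ≤ (∫⁻ x, (q x)⁻¹ ∂μ) * ∫⁻ x, q x * f x ^ 2 ∂μ := by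
  have H := ENNReal.lintegral_mul_le_Lp_mul_Lq μ Real.HolderConjugate.two_two
    (f := fun x => (q x)⁻¹ ^ (1 / 2 : ℝ)) (g := fun x => q x ^ (1 / 2 : ℝ) * f x)
    (by fun_prop) (by fun_prop)
  have e1 : ∀ x, ((fun x => (q x)⁻¹ ^ (1 / 2 : ℝ)) * (fun x => q x ^ (1 / 2 : ℝ) * f x)) x = f x := by
    intro x
    simp only [Pi.mul_apply]
    rw [← mul_assoc, ← ENNReal.mul_rpow_of_nonneg _ _ (by norm_num),
      ENNReal.inv_mul_cancel (h0 x) (ht x), ENNReal.one_rpow, one_mul]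
  have e2 : ∀ x, ((q x)⁻¹ ^ (1 / 2 : ℝ)) ^ (2 : ℝ) = (q x)⁻¹ := by
    intro x
    rw [← ENNReal.rpow_mul]; norm_num
  have e3 : ∀ x, (q x ^ (1 / 2 : ℝ) * f x) ^ (2 : ℝ) = q x * f x ^ 2 := by
    intro x
    rw [ENNReal.mul_rpow_of_nonneg _ _ (by norm_num), ← ENNReal.rpow_mul]; norm_num
  simp only [e1, e2, e3] at H
  calc _ ≤ ((∫⁻ x, (q x)⁻¹ ∂μ) ^ (1 / 2 : ℝ) * (∫⁻ x, q x * f x ^ 2 ∂μ) ^ (1 / 2 : ℝ)) ^ 2 := by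
        gcongr
    _ = _ := by
        rw [mul_pow, ← ENNReal.rpow_natCast, ← ENNReal.rpow_natCast, ← ENNReal.rpow_mul,
          ← ENNReal.rpow_mul]
        norm_num

/-- product weight -/
noncomputable def Pw {d n : ℕ} (ξ : Fin n → Fin d → ℝ) : ℝ≥0∞ := ∏ l, ENNReal.ofReal (jb (ξ l))

lemma measurable_Pw {d n : ℕ} : Measurable (Pw (d := d) (n := n)) := by
  unfold Pw
  have := (continuous_jb (d := d)).measurable
  fun_prop

lemma Pw_ne_zero {d n : ℕ} (ξ : Fin n → Fin d → ℝ) : Pw ξ ≠ 0 :=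
  Finset.prod_ne_zero_iff.2 fun l _ => by simpa using jb_pos (ξ l)

lemma Pw_ne_top {d n : ℕ} (ξ : Fin n → Fin d → ℝ) : Pw ξ ≠ ⊤ :=
  ENNReal.prod_ne_top fun l _ => ENNReal.ofReal_ne_top

lemma jw_one {d : ℕ} (v : Fin d → ℝ) : jw 1 v = (ENNReal.ofReal (jb v))⁻¹ := by
  unfold jw
  rw [Real.rpow_neg_one, ENNReal.ofReal_inv_of_pos (jb_pos v)]

lemma Pw_inv {d n : ℕ} (ξ : Fin n → Fin d → ℝ) : (Pw ξ)⁻¹ = ∏ l, jw 1 (ξ l) := by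
  unfold Pw
  simp only [jw_one]
  rw [ENNReal.prod_inv_distrib]
  intro i _ j _ _
  exact Or.inr ENNReal.ofReal_ne_top

/-- The Fourier side of the contraction. -/
noncomputable def Gfun {d k p : ℕ} (j : Fin k)
    (a b : (Fin k → Fin d → ℝ) × (Fin p → Fin d → ℝ) → ℂ)
    (ξ : (Fin k → Fin d → ℝ) × (Fin k → Fin d → ℝ)) : ℂ :=
  ∫ η : (Fin p → Fin d → ℝ) × (Fin p → Fin d → ℝ),
    a (ξ.1 - Pi.single j (∑ m, η.1 m + ∑ m, η.2 m), η.1) * b (ξ.2, η.2)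

lemma measurable_T {d k p : ℕ} (j : Fin k) :
    Measurable (fun η : (Fin p → Fin d → ℝ) × (Fin p → Fin d → ℝ) =>
      (Pi.single j (∑ m, η.1 m + ∑ m, η.2 m) : Fin k → Fin d → ℝ)) := by
  apply Continuous.measurable
  exact (continuous_single (A := fun _ : Fin k => Fin d → ℝ) j).comp (by fun_prop)

noncomputable def wsq {d k : ℕ} (α : ℝ) (ξ : (Fin k → Fin d → ℝ) × (Fin k → Fin d → ℝ)) : ℝ≥0∞ :=
  (∏ l, jw α (ξ.1 l)) * ∏ l, jw α (ξ.2 l)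

noncomputable def Nsq {d k p : ℕ} (a : (Fin k → Fin d → ℝ) × (Fin p → Fin d → ℝ) → ℂ) : ℝ≥0∞ :=
  ∫⁻ z, Pw z.1 * Pw z.2 * ‖a z‖ₑ ^ 2

lemma core_ptwise {d k p : ℕ} {α : ℝ} (h1 : α ≤ 1) (j : Fin k) (C : ℝ≥0∞)
    (hC : ∀ ξ : Fin d → ℝ,
      ∫⁻ η : (Fin p → Fin d → ℝ) × (Fin p → Fin d → ℝ),
        jw 1 (ξ - (∑ m, η.1 m + ∑ m, η.2 m)) * ((∏ m, jw 1 (η.1 m)) * ∏ m, jw 1 (η.2 m))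
        ≤ C * jw α ξ)
    (a b : (Fin k → Fin d → ℝ) × (Fin p → Fin d → ℝ) → ℂ) (ha : Measurable a) (hb : Measurable b)
    (ξ : (Fin k → Fin d → ℝ) × (Fin k → Fin d → ℝ)) :
    ‖Gfun j a b ξ‖ₑ ^ 2 ≤ C * wsq α ξ *
      ∫⁻ η : (Fin p → Fin d → ℝ) × (Fin p → Fin d → ℝ),
        (Pw (ξ.1 - Pi.single j (∑ m, η.1 m + ∑ m, η.2 m)) * Pw η.1 *
          ‖a (ξ.1 - Pi.single j (∑ m, η.1 m + ∑ m, η.2 m), η.1)‖ₑ ^ 2) *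
        (Pw ξ.2 * Pw η.2 * ‖b (ξ.2, η.2)‖ₑ ^ 2) := by
  have hT := measurable_T (d := d) (p := p) j
  have hP := measurable_Pw (d := d) (n := k)
  have hP' := measurable_Pw (d := d) (n := p)
  set T := (fun η : (Fin p → Fin d → ℝ) × (Fin p → Fin d → ℝ) =>
      (Pi.single j (∑ m, η.1 m + ∑ m, η.2 m) : Fin k → Fin d → ℝ)) with hTdef
  set q : (Fin p → Fin d → ℝ) × (Fin p → Fin d → ℝ) → ℝ≥0∞ := fun η =>
    (Pw (ξ.1 - T η) * Pw η.1) * (Pw ξ.2 * Pw η.2) with hq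
  have hqm : Measurable q := by fun_prop
  have step1 : ‖Gfun j a b ξ‖ₑ ≤ ∫⁻ η, ‖a (ξ.1 - T η, η.1)‖ₑ * ‖b (ξ.2, η.2)‖ₑ := by
    unfold Gfun
    refine (enorm_integral_le_lintegral_enorm _).trans (le_of_eq ?_)
    simp only [enorm_mul, hTdef]
  have step2 : ∫⁻ η, (q η)⁻¹ ≤ C * wsq α ξ := by
    have e : ∀ η, (q η)⁻¹ = ((∏ l ∈ Finset.univ.erase j, jw 1 (ξ.1 l)) * ∏ l, jw 1 (ξ.2 l)) *
        (jw 1 (ξ.1 j - (∑ m, η.1 m + ∑ m, η.2 m)) *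
          ((∏ m, jw 1 (η.1 m)) * ∏ m, jw 1 (η.2 m))) := by
      intro η
      simp only [hq]
      rw [ENNReal.mul_inv (Or.inl (mul_ne_zero (Pw_ne_zero _) (Pw_ne_zero _)))
          (Or.inl (ENNReal.mul_ne_top (Pw_ne_top _) (Pw_ne_top _))),
        ENNReal.mul_inv (Or.inl (Pw_ne_zero _)) (Or.inl (Pw_ne_top _)),
        ENNReal.mul_inv (Or.inl (Pw_ne_zero _)) (Or.inl (Pw_ne_top _)),
        Pw_inv, Pw_inv, Pw_inv, Pw_inv]
      rw [← Finset.mul_prod_erase Finset.univ (fun l => jw 1 ((ξ.1 - T η) l)) (Finset.mem_univ j)]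
      have : ∏ l ∈ Finset.univ.erase j, jw 1 ((ξ.1 - T η) l) =
          ∏ l ∈ Finset.univ.erase j, jw 1 (ξ.1 l) := by
        apply Finset.prod_congr rfl
        intro l hl
        have : l ≠ j := Finset.ne_of_mem_erase hl
        simp [hTdef, Pi.single_eq_of_ne this]
      rw [this]
      have : (ξ.1 - T η) j = ξ.1 j - (∑ m, η.1 m + ∑ m, η.2 m) := by
        simp [hTdef]
      simp only [this]
      ring
    have hj := fun s => measurable_jw (d := d) s
    simp only [e]
    rw [lintegral_const_mul _ (by fun_prop)]
    calc _ ≤ ((∏ l ∈ Finset.univ.erase j, jw α (ξ.1 l)) * ∏ l, jw α (ξ.2 l)) *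
          (C * jw α (ξ.1 j)) := by
            gcongr
            · exact jw_antitone h1 _
            · exact jw_antitone h1 _
            · exact hC _
      _ = C * wsq α ξ := by
        unfold wsq
        rw [← Finset.mul_prod_erase Finset.univ (fun l => jw α (ξ.1 l)) (Finset.mem_univ j)]
        ring
  calc ‖Gfun j a b ξ‖ₑ ^ 2 ≤ (∫⁻ η, ‖a (ξ.1 - T η, η.1)‖ₑ * ‖b (ξ.2, η.2)‖ₑ) ^ 2 := by gcongr
    _ ≤ (∫⁻ η, (q η)⁻¹) * ∫⁻ η, q η * (‖a (ξ.1 - T η, η.1)‖ₑ * ‖b (ξ.2, η.2)‖ₑ) ^ 2 := by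
      apply cs_weight _ _ _ _ hqm
      · intro η
        simp [hq, Pw_ne_zero]
      · intro η
        exact ENNReal.mul_ne_top (ENNReal.mul_ne_top (Pw_ne_top _) (Pw_ne_top _))
          (ENNReal.mul_ne_top (Pw_ne_top _) (Pw_ne_top _))
      · fun_prop
    _ ≤ (C * wsq α ξ) * ∫⁻ η, q η * (‖a (ξ.1 - T η, η.1)‖ₑ * ‖b (ξ.2, η.2)‖ₑ) ^ 2 := by gcongr
    _ = _ := by
      congr 1
      apply lintegral_congr
      intro η
      simp only [hq, hTdef]
      ring

lemma wsq_ne_zero {d k : ℕ} (α : ℝ) (ξ : (Fin k → Fin d → ℝ) × (Fin k → Fin d → ℝ)) :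
    wsq α ξ ≠ 0 := by
  have : ∀ v : Fin d → ℝ, jw α v ≠ 0 := fun v => by
    unfold jw; simpa using Real.rpow_pos_of_pos (jb_pos v) _
  exact mul_ne_zero (Finset.prod_ne_zero_iff.2 fun _ _ => this _)
    (Finset.prod_ne_zero_iff.2 fun _ _ => this _)

lemma wsq_ne_top {d k : ℕ} (α : ℝ) (ξ : (Fin k → Fin d → ℝ) × (Fin k → Fin d → ℝ)) :
    wsq α ξ ≠ ⊤ := by
  exact ENNReal.mul_ne_top (ENNReal.prod_ne_top fun _ _ => ENNReal.ofReal_ne_top)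
    (ENNReal.prod_ne_top fun _ _ => ENNReal.ofReal_ne_top)

lemma core_bound {d k p : ℕ} {α : ℝ} (h1 : α ≤ 1) (j : Fin k) (C : ℝ≥0∞)
    (hC : ∀ ξ : Fin d → ℝ,
      ∫⁻ η : (Fin p → Fin d → ℝ) × (Fin p → Fin d → ℝ),
        jw 1 (ξ - (∑ m, η.1 m + ∑ m, η.2 m)) * ((∏ m, jw 1 (η.1 m)) * ∏ m, jw 1 (η.2 m))
        ≤ C * jw α ξ)
    (a b : (Fin k → Fin d → ℝ) × (Fin p → Fin d → ℝ) → ℂ) (ha : Measurable a) (hb : Measurable b) :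
    ∫⁻ ξ, (wsq α ξ)⁻¹ * ‖Gfun j a b ξ‖ₑ ^ 2 ≤ C * (Nsq a * Nsq b) := by
  have hT := measurable_T (d := d) (p := p) j
  have hP := measurable_Pw (d := d) (n := k)
  have hP' := measurable_Pw (d := d) (n := p)
  set H : ((Fin k → Fin d → ℝ) × (Fin p → Fin d → ℝ)) × ((Fin k → Fin d → ℝ) × (Fin p → Fin d → ℝ))
    → ℝ≥0∞ := fun z => (Pw z.1.1 * Pw z.1.2 * ‖a z.1‖ₑ ^ 2) * (Pw z.2.1 * Pw z.2.2 * ‖b z.2‖ₑ ^ 2)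
    with hH
  have hHm : Measurable H := by fun_prop
  have hmp := mp_shear (volume : Measure (Fin k → Fin d → ℝ)) (volume : Measure (Fin p → Fin d → ℝ))
    _ hT
  calc _ ≤ ∫⁻ ξ : (Fin k → Fin d → ℝ) × (Fin k → Fin d → ℝ), C * ∫⁻ η : (Fin p → Fin d → ℝ) × (Fin p → Fin d → ℝ),
        H ((ξ.1 - Pi.single j (∑ m, η.1 m + ∑ m, η.2 m), η.1), (ξ.2, η.2)) := by
        apply lintegral_mono
        intro ξ
        have hc := core_ptwise h1 j C hC a b ha hb ξ
        simp only [hH]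
        generalize (∫⁻ η : (Fin p → Fin d → ℝ) × (Fin p → Fin d → ℝ),
          (Pw (ξ.1 - Pi.single j (∑ m, η.1 m + ∑ m, η.2 m)) * Pw η.1 *
            ‖a (ξ.1 - Pi.single j (∑ m, η.1 m + ∑ m, η.2 m), η.1)‖ₑ ^ 2) *
          (Pw ξ.2 * Pw η.2 * ‖b (ξ.2, η.2)‖ₑ ^ 2)) = I at hc ⊢
        calc _ ≤ (wsq α ξ)⁻¹ * (C * wsq α ξ * I) := mul_le_mul_right hc _
          _ = ((wsq α ξ)⁻¹ * wsq α ξ) * (C * I) := by ring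
          _ = _ := by rw [ENNReal.inv_mul_cancel (wsq_ne_zero _ _) (wsq_ne_top _ _), one_mul]
    _ = C * ∫⁻ z : ((Fin k → Fin d → ℝ) × (Fin k → Fin d → ℝ)) × ((Fin p → Fin d → ℝ) × (Fin p → Fin d → ℝ)),
        H ((z.1.1 - Pi.single j (∑ m, z.2.1 m + ∑ m, z.2.2 m), z.2.1), (z.1.2, z.2.2)) := by
        have hm : Measurable fun z : ((Fin k → Fin d → ℝ) × (Fin k → Fin d → ℝ)) × ((Fin p → Fin d → ℝ) × (Fin p → Fin d → ℝ)) =>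
          H ((z.1.1 - Pi.single j (∑ m, z.2.1 m + ∑ m, z.2.2 m), z.2.1), (z.1.2, z.2.2)) :=
            hHm.comp hmp.measurable
        rw [lintegral_const_mul _ hm.lintegral_prod_right', Measure.volume_eq_prod (_ × _) (_ × _),
          lintegral_prod _ hm.aemeasurable]
    _ = C * ∫⁻ z, H z := by
        congr 1
        exact hmp.lintegral_comp hHm
    _ = C * (Nsq a * Nsq b) := by
        congr 1
        simp only [hH]
        exact lintegral_prod_mul (μ := volume) (ν := volume)
          (f := fun z : (Fin k → Fin d → ℝ) × (Fin p → Fin d → ℝ) => Pw z.1 * Pw z.2 * ‖a z‖ₑ ^ 2)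
          (g := fun z : (Fin k → Fin d → ℝ) × (Fin p → Fin d → ℝ) => Pw z.1 * Pw z.2 * ‖b z‖ₑ ^ 2)
          (by fun_prop) (by fun_prop)

noncomputable def dotp {n d : ℕ} (x ξ : Fin n → Fin d → ℝ) : ℝ := ∑ l, ∑ i, x l i * ξ l i

lemma continuous_dotp {n d : ℕ} (x : Fin n → Fin d → ℝ) : Continuous (dotp x) := by
  unfold dotp; fun_prop

noncomputable def ee (t : ℝ) : ℂ := Complex.exp (↑(2 * Real.pi * t) * Complex.I)

lemma ee_add (s t : ℝ) : ee (s + t) = ee s * ee t := by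
  unfold ee
  rw [← Complex.exp_add]
  congr 1
  push_cast
  ring

lemma norm_ee (t : ℝ) : ‖ee t‖ = 1 := Complex.norm_exp_ofReal_mul_I _

lemma continuous_ee : Continuous ee := by unfold ee; fun_prop

/-- inverse Fourier integral in product coordinates -/
noncomputable def fI {d k p : ℕ} (a : (Fin k → Fin d → ℝ) × (Fin p → Fin d → ℝ) → ℂ)
    (x : Fin k → Fin d → ℝ) (y : Fin p → Fin d → ℝ) : ℂ :=
  ∫ z, ee (dotp x z.1 + dotp y z.2) * a z

lemma integrable_ee_mul {Ω : Type*} [TopologicalSpace Ω] [MeasurableSpace Ω] [OpensMeasurableSpace Ω]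
    {μ : Measure Ω} {a : Ω → ℂ} {φ : Ω → ℝ} (ha : Integrable a μ) (hφ : Continuous φ) :
    Integrable (fun z => ee (φ z) * a z) μ := by
  refine ha.bdd_mul (c := 1) ?_ ?_
  · exact (continuous_ee.comp hφ).aestronglyMeasurable
  · exact Filter.Eventually.of_forall fun z => (norm_ee _).le

lemma dot_shift {d k p : ℕ} (j : Fin k) (x ξ : Fin k → Fin d → ℝ) (η η' : Fin p → Fin d → ℝ) :
    dotp x (ξ - Pi.single j (∑ m, η m + ∑ m, η' m)) + dotp (fun _ => x j) η
      + dotp (fun _ => x j) η' = dotp x ξ := by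
  unfold dotp
  have h1 : ∑ l, ∑ i, x l i * (ξ - Pi.single j (∑ m, η m + ∑ m, η' m) : Fin k → Fin d → ℝ) l i =
      ∑ l, ∑ i, x l i * ξ l i - ∑ i, x j i * (∑ m, η m i + ∑ m, η' m i) := by
    have : ∀ l, ∑ i, x l i * (ξ - Pi.single j (∑ m, η m + ∑ m, η' m) : Fin k → Fin d → ℝ) l i =
        ∑ i, x l i * ξ l i - (if l = j then ∑ i, x j i * (∑ m, η m i + ∑ m, η' m i) else 0) := by
      intro l
      by_cases h : l = j
      · subst h
        simp [mul_sub, Finset.sum_sub_distrib]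
      · simp [h]
    simp only [this, Finset.sum_sub_distrib]
    simp
  rw [h1, Finset.sum_comm (f := fun (m : Fin p) (i : Fin d) => x j i * η m i),
    Finset.sum_comm (f := fun (m : Fin p) (i : Fin d) => x j i * η' m i)]
  simp only [mul_add, Finset.sum_add_distrib, Finset.mul_sum]
  ring

lemma emb_shear {d k p : ℕ} (j : Fin k) :
    MeasurableEmbedding (fun z : ((Fin k → Fin d → ℝ) × (Fin k → Fin d → ℝ)) ×
        ((Fin p → Fin d → ℝ) × (Fin p → Fin d → ℝ)) =>
      ((z.1.1 - Pi.single j (∑ m, z.2.1 m + ∑ m, z.2.2 m), z.2.1), (z.1.2, z.2.2))) := by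
  have hmp := mp_shear (volume : Measure (Fin k → Fin d → ℝ)) (volume : Measure (Fin p → Fin d → ℝ))
    _ (measurable_T (d := d) (p := p) j)
  have hT := measurable_T (d := d) (p := p) j
  let e : (((Fin k → Fin d → ℝ) × (Fin k → Fin d → ℝ)) ×
        ((Fin p → Fin d → ℝ) × (Fin p → Fin d → ℝ))) ≃ᵐ
      (((Fin k → Fin d → ℝ) × (Fin p → Fin d → ℝ)) ×
        ((Fin k → Fin d → ℝ) × (Fin p → Fin d → ℝ))) :=
    { toFun := fun z =>
        ((z.1.1 - Pi.single j (∑ m, z.2.1 m + ∑ m, z.2.2 m), z.2.1), (z.1.2, z.2.2))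
      invFun := fun z =>
        ((z.1.1 + Pi.single j (∑ m, z.1.2 m + ∑ m, z.2.2 m), z.2.1), (z.1.2, z.2.2))
      left_inv := fun z => by simp
      right_inv := fun z => by simp
      measurable_toFun := hmp.measurable
      measurable_invFun := by
        have h2 : Measurable (fun z : ((Fin k → Fin d → ℝ) × (Fin p → Fin d → ℝ)) ×
          ((Fin k → Fin d → ℝ) × (Fin p → Fin d → ℝ)) => (z.1.2, z.2.2)) := by fun_prop
        have h3 := hT.comp h2
        exact Measurable.prodMk (Measurable.prodMk ((measurable_fst.comp measurable_fst).add h3)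
          (measurable_fst.comp measurable_snd)) h2 }
  exact e.measurableEmbedding

lemma integrable_Gfun {d k p : ℕ} (j : Fin k)
    (a b : (Fin k → Fin d → ℝ) × (Fin p → Fin d → ℝ) → ℂ) (ha : Integrable a) (hb : Integrable b) :
    Integrable (Gfun j a b) := by
  have hmp := mp_shear (volume : Measure (Fin k → Fin d → ℝ)) (volume : Measure (Fin p → Fin d → ℝ))
    _ (measurable_T (d := d) (p := p) j)
  have h := (hmp.integrable_comp_emb (emb_shear j)).2 (ha.mul_prod hb)
  exact h.integral_prod_left

lemma repr_Gfun {d k p : ℕ} (j : Fin k)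
    (a b : (Fin k → Fin d → ℝ) × (Fin p → Fin d → ℝ) → ℂ) (ha : Integrable a) (hb : Integrable b)
    (x x' : Fin k → Fin d → ℝ) :
    fI a x (fun _ => x j) * fI b x' (fun _ => x j) =
      ∫ ξ : (Fin k → Fin d → ℝ) × (Fin k → Fin d → ℝ),
        ee (dotp x ξ.1 + dotp x' ξ.2) * Gfun j a b ξ := by
  have hmp := mp_shear (volume : Measure (Fin k → Fin d → ℝ)) (volume : Measure (Fin p → Fin d → ℝ))
    _ (measurable_T (d := d) (p := p) j)
  have ha' : Integrable (fun z : (Fin k → Fin d → ℝ) × (Fin p → Fin d → ℝ) =>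
      ee (dotp x z.1 + dotp (fun _ => x j) z.2) * a z) :=
    integrable_ee_mul ha (((continuous_dotp _).comp continuous_fst).add
      ((continuous_dotp _).comp continuous_snd))
  have hb' : Integrable (fun z : (Fin k → Fin d → ℝ) × (Fin p → Fin d → ℝ) =>
      ee (dotp x' z.1 + dotp (fun _ => x j) z.2) * b z) :=
    integrable_ee_mul hb (((continuous_dotp _).comp continuous_fst).add
      ((continuous_dotp _).comp continuous_snd))
  have h := (hmp.integrable_comp_emb (emb_shear j)).2 (ha'.mul_prod hb')
  have h2 := hmp.integral_comp (emb_shear j) (fun z =>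
    (ee (dotp x z.1.1 + dotp (fun _ => x j) z.1.2) * a z.1) *
      (ee (dotp x' z.2.1 + dotp (fun _ => x j) z.2.2) * b z.2))
  unfold fI
  rw [← integral_prod_mul]
  refine h2.symm.trans ?_
  refine (integral_prod _ h).trans ?_
  apply integral_congr_ae
  refine Filter.Eventually.of_forall fun ξ => ?_
  simp only [Gfun]
  rw [← integral_const_mul]
  apply integral_congr_ae
  refine Filter.Eventually.of_forall fun η => ?_
  simp only [Function.comp]
  rw [← dot_shift j x ξ.1 η.1 η.2]
  simp only [ee_add]
  ring

lemma continuous_Gfun {d k p : ℕ} (j : Fin k)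
    (a b : (Fin k → Fin d → ℝ) × (Fin p → Fin d → ℝ) → ℂ) (ha : Continuous a) (hb : Continuous b)
    (u v : (Fin p → Fin d → ℝ) → ℝ) (hu : Integrable u) (hv : Integrable v)
    (hau : ∀ z, ‖a z‖ ≤ u z.2) (hbv : ∀ z, ‖b z‖ ≤ v z.2) :
    Continuous (Gfun j a b) := by
  have hc : Continuous (fun σ : Fin d → ℝ => (Pi.single j σ : Fin k → Fin d → ℝ)) :=
    continuous_single (A := fun _ : Fin k => Fin d → ℝ) j
  unfold Gfun
  refine continuous_of_dominated (bound := fun η => u η.1 * v η.2) ?_ ?_ (hu.mul_prod hv) ?_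
  · intro ξ
    apply Continuous.aestronglyMeasurable
    fun_prop
  · intro ξ
    refine Filter.Eventually.of_forall fun η => ?_
    rw [norm_mul]
    exact mul_le_mul (hau _) (hbv _) (norm_nonneg _) ((norm_nonneg _).trans (hau (ξ.1, η.1)))
  · refine Filter.Eventually.of_forall fun η => ?_
    fun_prop

lemma mp_curry_symm (n d : ℕ) : MeasurePreserving
    (fun (x : Fin n → Fin d → ℝ) (q : Fin n × Fin d) => x q.1 q.2) := by
  have hm : Measurable (fun (x : Fin n → Fin d → ℝ) (q : Fin n × Fin d) => x q.1 q.2) := by fun_prop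
  refine ⟨hm, ?_⟩
  symm
  apply Measure.pi_eq
  intro s hs
  rw [Measure.map_apply hm (MeasurableSet.univ_pi hs)]
  have : (fun (x : Fin n → Fin d → ℝ) (q : Fin n × Fin d) => x q.1 q.2) ⁻¹' Set.univ.pi s =
      Set.univ.pi (fun l => Set.univ.pi (fun i => s (l, i))) := by
    ext x
    simp [Set.mem_pi]
  rw [this, volume_pi_pi, Fintype.prod_prod_type]
  simp only [volume_pi_pi]

def curryE (n d : ℕ) : (Fin n × Fin d → ℝ) ≃ᵐ (Fin n → Fin d → ℝ) where
  toFun x l i := x (l, i)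
  invFun x q := x q.1 q.2
  left_inv _ := rfl
  right_inv _ := rfl
  measurable_toFun := by
    refine measurable_pi_lambda _ fun l => measurable_pi_lambda _ fun i => measurable_pi_apply _
  measurable_invFun := (mp_curry_symm n d).measurable

lemma mp_curryE (n d : ℕ) : MeasurePreserving (curryE n d) :=
  MeasurePreserving.symm (curryE n d).symm (mp_curry_symm n d)

def PsiE (d n : ℕ) : PairSpace d n ≃ᵐ (Fin n → Fin d → ℝ) × (Fin n → Fin d → ℝ) :=
  (MeasurableEquiv.toLp 2 _).symm.trans
    ((MeasurableEquiv.sumPiEquivProdPi (fun _ : (Fin n × Fin d) ⊕ (Fin n × Fin d) => ℝ)).trans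
      ((curryE n d).prodCongr (curryE n d)))

lemma PsiE_apply (d n : ℕ) (z : PairSpace d n) : PsiE d n z =
    (fun l i => z (Sum.inl (l, i)), fun l i => z (Sum.inr (l, i))) := rfl

lemma mp_PsiE (d n : ℕ) : MeasurePreserving (PsiE d n) :=
  ((mp_curryE n d).prod (mp_curryE n d)).comp
    ((volume_measurePreserving_sumPiEquivProdPi
      (fun _ : (Fin n × Fin d) ⊕ (Fin n × Fin d) => ℝ)).comp
      (PiLp.volume_preserving_ofLp _))

lemma continuous_PsiE (d n : ℕ) : Continuous (PsiE d n) := by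
  have : (PsiE d n : PairSpace d n → _) = fun z =>
    (fun l i => z (Sum.inl (l, i)), fun l i => z (Sum.inr (l, i))) := rfl
  rw [this]
  fun_prop

lemma inner_PsiE (d n : ℕ) (z ζ : PairSpace d n) : inner ℝ ζ z =
    dotp (PsiE d n z).1 (PsiE d n ζ).1 + dotp (PsiE d n z).2 (PsiE d n ζ).2 := by
  simp [PiLp.inner_apply, PsiE_apply, dotp, Fintype.sum_sum_type, Fintype.sum_prod_type]

def PhiE (d k p : ℕ) : EuclideanSpace ℝ (Fin (k + p) × Fin d) ≃ᵐ
    (Fin k → Fin d → ℝ) × (Fin p → Fin d → ℝ) :=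
  (MeasurableEquiv.toLp 2 _).symm.trans
    ((curryE (k + p) d).trans
      ((MeasurableEquiv.piCongrLeft (fun _ => Fin d → ℝ) finSumFinEquiv).symm.trans
      (MeasurableEquiv.sumPiEquivProdPi (fun _ : (Fin k) ⊕ (Fin p) => Fin d → ℝ))))

lemma PhiE_apply (d k p : ℕ) (z : EuclideanSpace ℝ (Fin (k + p) × Fin d)) : PhiE d k p z =
    (fun l i => z (Fin.castAdd p l, i), fun l i => z (Fin.natAdd k l, i)) := rfl

lemma mp_PhiE (d k p : ℕ) : MeasurePreserving (PhiE d k p) :=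
  (volume_measurePreserving_sumPiEquivProdPi _).comp
    (((volume_measurePreserving_piCongrLeft (fun _ => Fin d → ℝ) finSumFinEquiv).symm).comp
      ((mp_curryE (k + p) d).comp (PiLp.volume_preserving_ofLp _)))

lemma PhiE_symm_apply (d k p : ℕ) (z : (Fin k → Fin d → ℝ) × (Fin p → Fin d → ℝ)) :
    (PhiE d k p).symm z = WithLp.toLp 2 (fun q => Fin.addCases (motive := fun _ => ℝ)
      (fun l => z.1 l q.2) (fun m => z.2 m q.2) q.1) := by
  rw [MeasurableEquiv.symm_apply_eq, PhiE_apply]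
  simp

lemma continuous_PhiE_symm (d k p : ℕ) : Continuous (PhiE d k p).symm := by
  have : ((PhiE d k p).symm : _ → _) = fun z => WithLp.toLp 2 (fun q => Fin.addCases (motive := fun _ => ℝ)
      (fun l => z.1 l q.2) (fun m => z.2 m q.2) q.1) := funext (PhiE_symm_apply d k p)
  rw [this]
  refine (PiLp.continuous_toLp 2 _).comp (continuous_pi ?_)
  rintro ⟨l, i⟩
  induction l using Fin.addCases <;> simp <;> fun_prop

lemma inner_PhiE (d k p : ℕ) (z ζ : EuclideanSpace ℝ (Fin (k + p) × Fin d)) : inner ℝ ζ z =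
    dotp (PhiE d k p z).1 (PhiE d k p ζ).1 + dotp (PhiE d k p z).2 (PhiE d k p ζ).2 := by
  simp [PiLp.inner_apply, PhiE_apply, dotp, Fintype.sum_prod_type, Fin.sum_univ_add]

lemma weight_PhiE (d k p : ℕ) (ξ : EuclideanSpace ℝ (Fin (k + p) × Fin d)) :
    ENNReal.ofReal (∏ l : Fin (k + p), (1 + ∑ i' : Fin d, (ξ (l, i')) ^ 2)) =
      Pw (PhiE d k p ξ).1 * Pw (PhiE d k p ξ).2 := by
  rw [Fin.prod_univ_add, ENNReal.ofReal_mul, ENNReal.ofReal_prod_of_nonneg,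
    ENNReal.ofReal_prod_of_nonneg]
  · rfl
  all_goals first
    | (intro l _; positivity)
    | (apply Finset.prod_nonneg; intro l _; positivity)

/-- weight in coordinates -/
lemma weightS_sq (d k : ℕ) (α : ℝ) (ζ : PairSpace d k) :
    ‖(weightS d k α ζ : ℂ)‖ₑ ^ 2 = (wsq α (PsiE d k ζ))⁻¹ := by
  have hpos : ∀ v : Fin d → ℝ, 0 < jb v ^ (α / 2) := fun v => Real.rpow_pos_of_pos (jb_pos v) _
  have h1 : weightS d k α ζ = ∏ l : Fin k, (jb ((PsiE d k ζ).1 l) ^ (α / 2) *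
      jb ((PsiE d k ζ).2 l) ^ (α / 2)) := rfl
  have hj : ∀ v : Fin d → ℝ, (jw α v)⁻¹ = ENNReal.ofReal (jb v ^ (α / 2)) ^ 2 := by
    intro v
    unfold jw
    rw [← ENNReal.ofReal_inv_of_pos (Real.rpow_pos_of_pos (jb_pos v) _), Real.rpow_neg (jb_pos v).le,
      inv_inv, ← ENNReal.ofReal_pow (hpos v).le, ← Real.rpow_natCast, ← Real.rpow_mul (jb_pos v).le]
    congr 2
    push_cast
    ring
  have hinv : ∀ x : Fin k → Fin d → ℝ, (∏ l, jw α (x l))⁻¹ = ∏ l, (jw α (x l))⁻¹ := fun x =>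
    ENNReal.prod_inv_distrib (fun i _ j _ _ => Or.inr ENNReal.ofReal_ne_top)
  have hnn : 0 ≤ weightS d k α ζ := by
    rw [h1]; exact Finset.prod_nonneg fun l _ => mul_nonneg (hpos _).le (hpos _).le
  have hne : ∀ x : Fin k → Fin d → ℝ, (∏ l, jw α (x l)) ≠ ⊤ := fun x =>
    ENNReal.prod_ne_top fun _ _ => ENNReal.ofReal_ne_top
  unfold wsq
  rw [ENNReal.mul_inv (Or.inr (hne _)) (Or.inl (hne _)), hinv, hinv]
  simp only [hj]
  rw [← ofReal_norm, Complex.norm_real, Real.norm_of_nonneg hnn, h1,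
    ENNReal.ofReal_prod_of_nonneg (fun l _ => mul_nonneg (hpos _).le (hpos _).le),
    ← Finset.prod_mul_distrib, ← Finset.prod_pow]
  apply Finset.prod_congr rfl
  intro l _
  rw [ENNReal.ofReal_mul (hpos _).le, mul_pow]

lemma continuous_weightS (d k : ℕ) (α : ℝ) : Continuous (weightS d k α) := by
  have h1 : weightS d k α = fun ζ => ∏ l : Fin k, (jb ((PsiE d k ζ).1 l) ^ (α / 2) *
      jb ((PsiE d k ζ).2 l) ^ (α / 2)) := rfl
  rw [h1]
  have h2 := continuous_PsiE d k
  have h3 := continuous_jbpow (d := d) (α / 2)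
  refine continuous_finsetProd _ fun l _ => ?_
  exact (h3.comp ((continuous_apply l).comp (continuous_fst.comp h2))).mul
    (h3.comp ((continuous_apply l).comp (continuous_snd.comp h2)))

lemma negInv_prod (d k p : ℕ) :
    (volume : Measure ((Fin k → Fin d → ℝ) × (Fin p → Fin d → ℝ))).IsNegInvariant := by
  constructor
  have h1 : MeasurePreserving (Neg.neg : (Fin k → Fin d → ℝ) → _) volume volume :=
    Measure.measurePreserving_neg _
  have h2 : MeasurePreserving (Neg.neg : (Fin p → Fin d → ℝ) → _) volume volume :=
    Measure.measurePreserving_neg _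
  exact (h1.prod h2).map_eq

lemma schwartz_decay {V : Type*} [NormedAddCommGroup V] [NormedSpace ℝ V] (g : SchwartzMap V ℂ)
    (N : ℕ) : ∃ C : ℝ, ∀ x, (1 + ‖x‖) ^ N * ‖g x‖ ≤ C := by
  refine ⟨2 ^ (N, 0).1 * ((Finset.Iic (N, 0)).sup fun m => SchwartzMap.seminorm ℝ m.1 m.2) g, fun x => ?_⟩
  have := SchwartzMap.one_add_le_sup_seminorm_apply (𝕜 := ℝ) (m := (N, 0)) (k := N) (n := 0)
    le_rfl le_rfl g x
  rw [norm_iteratedFDeriv_zero] at this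
  exact this

/-- regularity package for the Fourier-side amplitudes -/
def Nice {d k p : ℕ} (a : (Fin k → Fin d → ℝ) × (Fin p → Fin d → ℝ) → ℂ) : Prop :=
  Continuous a ∧ Integrable a ∧
    ∃ u : (Fin p → Fin d → ℝ) → ℝ, Integrable u ∧ ∀ z, ‖a z‖ ≤ u z.2

noncomputable def cneg {d k p : ℕ} (a : (Fin k → Fin d → ℝ) × (Fin p → Fin d → ℝ) → ℂ)
    (z : (Fin k → Fin d → ℝ) × (Fin p → Fin d → ℝ)) : ℂ := (starRingEnd ℂ) (a (-z))

noncomputable def aF {d k p : ℕ} (g : SchwartzMap (EuclideanSpace ℝ (Fin (k + p) × Fin d)) ℂ)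
    (z : (Fin k → Fin d → ℝ) × (Fin p → Fin d → ℝ)) : ℂ := g ((PhiE d k p).symm z)

lemma nice_cneg {d k p : ℕ} {a : (Fin k → Fin d → ℝ) × (Fin p → Fin d → ℝ) → ℂ}
    (h : Nice a) : Nice (cneg a) := by
  have := negInv_prod d k p
  obtain ⟨h1, h2, u, hu, hau⟩ := h
  refine ⟨?_, ?_, fun y => u (-y), hu.comp_neg, fun z => ?_⟩
  · unfold cneg
    exact Complex.continuous_conj.comp (h1.comp continuous_neg)
  · have := h2.comp_neg
    have h3 : Integrable (fun z => (starRingEnd ℂ) (a (-z))) :=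
      (LinearIsometryEquiv.integrable_comp_iff Complex.conjLIE).2 this
    exact h3
  · unfold cneg
    rw [RCLike.norm_conj]
    exact hau (-z)

lemma jb_neg {d : ℕ} (v : Fin d → ℝ) : jb (-v) = jb v := by simp [jb]

lemma Pw_neg {d n : ℕ} (x : Fin n → Fin d → ℝ) : Pw (-x) = Pw x := by
  unfold Pw
  simp [jb_neg]

lemma Nsq_cneg {d k p : ℕ} (a : (Fin k → Fin d → ℝ) × (Fin p → Fin d → ℝ) → ℂ) :
    Nsq (cneg a) = Nsq a := by
  have := negInv_prod d k p
  unfold Nsq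
  rw [← lintegral_neg_eq_self]
  simp [cneg, Pw_neg]

lemma dotp_neg {n d : ℕ} (x ξ : Fin n → Fin d → ℝ) : dotp x (-ξ) = -dotp x ξ := by
  simp [dotp]

lemma ee_neg (t : ℝ) : ee (-t) = (starRingEnd ℂ) (ee t) := by
  unfold ee
  rw [← Complex.exp_conj]
  congr 1
  rw [map_mul, Complex.conj_ofReal, Complex.conj_I]
  push_cast
  ring

lemma fI_cneg {d k p : ℕ} (a : (Fin k → Fin d → ℝ) × (Fin p → Fin d → ℝ) → ℂ)
    (x : Fin k → Fin d → ℝ) (y : Fin p → Fin d → ℝ) :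
    fI (cneg a) x y = (starRingEnd ℂ) (fI a x y) := by
  have := negInv_prod d k p
  unfold fI
  rw [← integral_conj, ← integral_neg_eq_self]
  congr 1
  ext z
  simp only [cneg, neg_neg, map_mul, Prod.fst_neg, Prod.snd_neg, dotp_neg, ← neg_add, ee_neg]

lemma norm_le_PhiE_symm {d k p : ℕ} (z : (Fin k → Fin d → ℝ) × (Fin p → Fin d → ℝ)) :
    ‖z.2‖ ≤ ‖(PhiE d k p).symm z‖ := by
  rw [pi_norm_le_iff_of_nonneg (norm_nonneg _)]
  intro m
  rw [pi_norm_le_iff_of_nonneg (norm_nonneg _)]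
  intro i
  have := PiLp.norm_apply_le ((PhiE d k p).symm z) (Fin.natAdd k m, i)
  rw [PhiE_symm_apply] at this ⊢
  simpa using this

lemma nice_aF {d k p : ℕ} (g : SchwartzMap (EuclideanSpace ℝ (Fin (k + p) × Fin d)) ℂ) :
    Nice (aF g) := by
  refine ⟨g.continuous.comp (continuous_PhiE_symm d k p), ?_, ?_⟩
  · exact ((mp_PhiE d k p).symm.integrable_comp_emb (PhiE d k p).symm.measurableEmbedding).2
      g.integrable
  · set N : ℕ := p * d + 1
    obtain ⟨C, hC⟩ : ∃ C : ℝ, ∀ x, (1 + ‖x‖) ^ N * ‖g x‖ ≤ C := schwartz_decay g N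
    refine ⟨fun y => C * (1 + ‖y‖) ^ (-(N : ℝ)), ?_, fun z => ?_⟩
    · apply Integrable.const_mul
      apply integrable_one_add_norm
      have : Module.finrank ℝ (Fin p → Fin d → ℝ) = p * d := by
        simp [Module.finrank_pi_fintype]
      rw [this]
      simp [N]
    · have h1 := hC ((PhiE d k p).symm z)
      have h2 := norm_le_PhiE_symm z
      have h3 : (0:ℝ) < 1 + ‖z.2‖ := by positivity
      beta_reduce
      rw [Real.rpow_neg h3.le, Real.rpow_natCast, ← div_eq_mul_inv, le_div_iff₀ (by positivity)]
      unfold aF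
      calc _ ≤ ‖g ((PhiE d k p).symm z)‖ * (1 + ‖(PhiE d k p).symm z‖) ^ N := by gcongr
        _ ≤ C := by linarith

lemma inversion_PhiE {d k p : ℕ} (f : SchwartzMap (EuclideanSpace ℝ (Fin (k + p) × Fin d)) ℂ)
    (w : EuclideanSpace ℝ (Fin (k + p) × Fin d)) :
    f w = fI (aF (𝓕 f)) (PhiE d k p w).1 (PhiE d k p w).2 := by
  have h1 : 𝓕⁻ (𝓕 (f : EuclideanSpace ℝ (Fin (k + p) × Fin d) → ℂ)) = f :=
    f.continuous.fourierInv_fourier_eq f.integrable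
      (by rw [← SchwartzMap.fourier_coe]; exact (𝓕 f).integrable)
  have h2 := congrFun h1 w
  rw [Real.fourierInv_eq'] at h2
  rw [← h2]
  unfold fI
  rw [← (mp_PhiE d k p).integral_comp (PhiE d k p).measurableEmbedding]
  congr 1
  ext v
  simp only [aF, MeasurableEquiv.symm_apply_apply, ← inner_PhiE, SchwartzMap.fourier_coe, ee, smul_eq_mul]

lemma Nsq_aF {d k p : ℕ} (f : SchwartzMap (EuclideanSpace ℝ (Fin (k + p) × Fin d)) ℂ) :
    Nsq (aF (𝓕 f)) = ENNReal.ofReal (∫ ξ : EuclideanSpace ℝ (Fin (k + p) × Fin d),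
                  (∏ l : Fin (k + p), (1 + ∑ i' : Fin d, (ξ (l, i')) ^ 2)) *
                    ‖𝓕 (⇑f) ξ‖ ^ 2) := by
  set g := 𝓕 f with hg
  rw [← SchwartzMap.fourier_coe, ← hg]
  have hw0 : ∀ ξ : EuclideanSpace ℝ (Fin (k + p) × Fin d),
      0 ≤ ∏ l : Fin (k + p), (1 + ∑ i' : Fin d, (ξ (l, i')) ^ 2) := fun ξ =>
    Finset.prod_nonneg fun l _ => by positivity
  have hwc : Continuous (fun ξ : EuclideanSpace ℝ (Fin (k + p) × Fin d) =>
      ∏ l : Fin (k + p), (1 + ∑ i' : Fin d, (ξ (l, i')) ^ 2)) := by fun_prop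
  have hint : Integrable (fun ξ : EuclideanSpace ℝ (Fin (k + p) × Fin d) =>
      (∏ l : Fin (k + p), (1 + ∑ i' : Fin d, (ξ (l, i')) ^ 2)) * ‖g ξ‖ ^ 2) := by
    set N : ℕ := 2 * (k + p)
    obtain ⟨C, hC⟩ : ∃ C : ℝ, ∀ x, (1 + ‖x‖) ^ N * ‖g x‖ ≤ C := schwartz_decay g N
    refine (g.integrable.norm.const_mul C).mono' ?_ ?_
    · exact (hwc.mul (g.continuous.norm.pow 2)).aestronglyMeasurable
    · refine Filter.Eventually.of_forall fun ξ => ?_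
      rw [Real.norm_of_nonneg (mul_nonneg (hw0 ξ) (by positivity))]
      have h1 : ∏ l : Fin (k + p), (1 + ∑ i' : Fin d, (ξ (l, i')) ^ 2) ≤ (1 + ‖ξ‖) ^ N := by
        calc _ ≤ ∏ l : Fin (k + p), (1 + ‖ξ‖) ^ 2 := by
              apply Finset.prod_le_prod (fun l _ => by positivity)
              intro l _
              have : ∑ i' : Fin d, (ξ (l, i')) ^ 2 ≤ ‖ξ‖ ^ 2 := by
                rw [EuclideanSpace.norm_sq_eq, Fintype.sum_prod_type]
                simp only [Real.norm_eq_abs, sq_abs]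
                exact Finset.single_le_sum (f := fun l => ∑ i' : Fin d, (ξ (l, i')) ^ 2)
                  (fun l _ => by positivity) (Finset.mem_univ l)
              nlinarith [norm_nonneg ξ]
          _ = _ := by simp [N, pow_mul]
      calc _ ≤ (1 + ‖ξ‖) ^ N * ‖g ξ‖ ^ 2 := by gcongr
        _ = ((1 + ‖ξ‖) ^ N * ‖g ξ‖) * ‖g ξ‖ := by ring
        _ ≤ C * ‖g ξ‖ := by gcongr; exact hC ξ
  rw [ofReal_integral_eq_lintegral_ofReal hint
    (Filter.Eventually.of_forall fun ξ => mul_nonneg (hw0 ξ) (by positivity))]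
  unfold Nsq
  rw [← (mp_PhiE d k p).lintegral_comp_emb (PhiE d k p).measurableEmbedding]
  congr 1
  ext ξ
  rw [ENNReal.ofReal_mul (hw0 ξ), weight_PhiE, ENNReal.ofReal_pow (norm_nonneg _), ofReal_norm]
  simp [aF]

noncomputable def Hfun {d k p : ℕ} (j : Fin k)
    (a : (Fin k → Fin d → ℝ) × (Fin p → Fin d → ℝ) → ℂ) (ζ : PairSpace d k) : ℂ :=
  Gfun j a (cneg a) (PsiE d k ζ) - Gfun j (cneg a) a (PsiE d k ζ).swap

lemma continuous_G_nice {d k p : ℕ} (j : Fin k)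
    {a b : (Fin k → Fin d → ℝ) × (Fin p → Fin d → ℝ) → ℂ} (ha : Nice a) (hb : Nice b) :
    Continuous (Gfun j a b) := by
  obtain ⟨h1, h2, u, hu, hau⟩ := ha
  obtain ⟨h1', h2', v, hv, hbv⟩ := hb
  exact continuous_Gfun j a b h1 h1' u v hu hv hau hbv

lemma mp_swapPsi (d k : ℕ) : MeasurePreserving (fun ζ : PairSpace d k => (PsiE d k ζ).swap) :=
  (Measure.measurePreserving_swap (μ := (volume : Measure (Fin k → Fin d → ℝ)))
    (ν := (volume : Measure (Fin k → Fin d → ℝ)))).comp (mp_PsiE d k)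

lemma emb_swapPsi (d k : ℕ) : MeasurableEmbedding (fun ζ : PairSpace d k => (PsiE d k ζ).swap) :=
  ((PsiE d k).trans MeasurableEquiv.prodComm).measurableEmbedding

lemma integrable_Hfun {d k p : ℕ} (j : Fin k)
    {a : (Fin k → Fin d → ℝ) × (Fin p → Fin d → ℝ) → ℂ} (ha : Nice a) :
    Integrable (Hfun j a) := by
  have hb := nice_cneg ha
  exact (((mp_PsiE d k).integrable_comp_emb (PsiE d k).measurableEmbedding).2
    (integrable_Gfun j _ _ ha.2.1 hb.2.1)).sub
    (((mp_swapPsi d k).integrable_comp_emb (emb_swapPsi d k)).2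
    (integrable_Gfun j _ _ hb.2.1 ha.2.1))

lemma continuous_Hfun {d k p : ℕ} (j : Fin k)
    {a : (Fin k → Fin d → ℝ) × (Fin p → Fin d → ℝ) → ℂ} (ha : Nice a) :
    Continuous (Hfun j a) := by
  have hb := nice_cneg ha
  exact ((continuous_G_nice j ha hb).comp (continuous_PsiE d k)).sub
    ((continuous_G_nice j hb ha).comp (continuous_swap.comp (continuous_PsiE d k)))

lemma fourierInv_Hfun {d k p : ℕ} (j : Fin k)
    {a : (Fin k → Fin d → ℝ) × (Fin p → Fin d → ℝ) → ℂ} (ha : Nice a) (z : PairSpace d k) :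
    𝓕⁻ (Hfun j a) z =
      fI a (PsiE d k z).1 (fun _ => (PsiE d k z).1 j) *
        (starRingEnd ℂ) (fI a (PsiE d k z).2 (fun _ => (PsiE d k z).1 j)) -
      fI a (PsiE d k z).1 (fun _ => (PsiE d k z).2 j) *
        (starRingEnd ℂ) (fI a (PsiE d k z).2 (fun _ => (PsiE d k z).2 j)) := by
  have hb := nice_cneg ha
  rw [← fI_cneg, ← fI_cneg, mul_comm (fI a _ fun _ => (PsiE d k z).2 j),
    repr_Gfun j a (cneg a) ha.2.1 hb.2.1, repr_Gfun j (cneg a) a hb.2.1 ha.2.1,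
    ← (mp_PsiE d k).integral_comp (PsiE d k).measurableEmbedding,
    ← (mp_swapPsi d k).integral_comp (emb_swapPsi d k), ← integral_sub, Real.fourierInv_eq']
  · congr 1
    ext ζ
    rw [inner_PsiE]
    simp only [Hfun, smul_eq_mul, mul_sub, Prod.fst_swap, Prod.snd_swap]
    rw [add_comm (dotp (PsiE d k z).2 _)]
    rfl
  · refine integrable_ee_mul (((mp_PsiE d k).integrable_comp_emb (PsiE d k).measurableEmbedding).2
      (integrable_Gfun j _ _ ha.2.1 hb.2.1)) ?_
    have := continuous_PsiE d k
    exact ((continuous_dotp _).comp (continuous_fst.comp this)).add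
      ((continuous_dotp _).comp (continuous_snd.comp this))
  · refine integrable_ee_mul (((mp_swapPsi d k).integrable_comp_emb (emb_swapPsi d k)).2
      (integrable_Gfun j _ _ hb.2.1 ha.2.1)) ?_
    have := continuous_PsiE d k
    exact ((continuous_dotp _).comp (continuous_snd.comp this)).add
      ((continuous_dotp _).comp (continuous_fst.comp this))

lemma wsq_swap {d k : ℕ} (α : ℝ) (ξ : (Fin k → Fin d → ℝ) × (Fin k → Fin d → ℝ)) :
    wsq α ξ.swap = wsq α ξ := mul_comm _ _

lemma eLpNorm_two_eq {Ω : Type*} [MeasurableSpace Ω] (μ : Measure Ω) (f : Ω → ℂ) :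
    eLpNorm f 2 μ = (∫⁻ x, ‖f x‖ₑ ^ 2 ∂μ) ^ (1 / 2 : ℝ) := by
  rw [eLpNorm_eq_lintegral_rpow_enorm_toReal (by norm_num) (by norm_num)]
  simp

lemma sqrt_bound (C N : ℝ≥0∞) : (C * (N * N)) ^ (1 / 2 : ℝ) = C ^ (1 / 2 : ℝ) * N := by
  rw [ENNReal.mul_rpow_of_nonneg _ _ (by norm_num), ← sq, ← ENNReal.rpow_natCast,
    ← ENNReal.rpow_mul]
  norm_num

lemma bound_Hfun {d k p : ℕ} {α : ℝ} (h1 : α ≤ 1) (j : Fin k) (C : ℝ≥0∞)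
    (hC : ∀ ξ : Fin d → ℝ,
      ∫⁻ η : (Fin p → Fin d → ℝ) × (Fin p → Fin d → ℝ),
        jw 1 (ξ - (∑ m, η.1 m + ∑ m, η.2 m)) * ((∏ m, jw 1 (η.1 m)) * ∏ m, jw 1 (η.2 m))
        ≤ C * jw α ξ)
    {a : (Fin k → Fin d → ℝ) × (Fin p → Fin d → ℝ) → ℂ} (ha : Nice a) :
    eLpNorm (fun ζ => (weightS d k α ζ : ℂ) * Hfun j a ζ) 2 volume ≤
      2 * C ^ (1 / 2 : ℝ) * Nsq a := by
  have hb := nice_cneg ha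
  have hw : Continuous (fun ζ => (weightS d k α ζ : ℂ)) :=
    Complex.continuous_ofReal.comp (continuous_weightS d k α)
  have e1 : eLpNorm (fun ζ => (weightS d k α ζ : ℂ) * Gfun j a (cneg a) (PsiE d k ζ)) 2 volume ≤
      C ^ (1 / 2 : ℝ) * Nsq a := by
    rw [eLpNorm_two_eq, ← sqrt_bound]
    refine ENNReal.rpow_le_rpow ?_ (by norm_num)
    have := core_bound h1 j C hC a (cneg a) ha.1.measurable hb.1.measurable
    rw [Nsq_cneg, ← (mp_PsiE d k).lintegral_comp_emb (PsiE d k).measurableEmbedding] at this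
    simpa only [enorm_mul, mul_pow, weightS_sq] using this
  have e2 : eLpNorm (fun ζ => (weightS d k α ζ : ℂ) * Gfun j (cneg a) a (PsiE d k ζ).swap) 2 volume ≤
      C ^ (1 / 2 : ℝ) * Nsq a := by
    rw [eLpNorm_two_eq, ← sqrt_bound]
    refine ENNReal.rpow_le_rpow ?_ (by norm_num)
    have := core_bound h1 j C hC (cneg a) a hb.1.measurable ha.1.measurable
    rw [Nsq_cneg, ← (mp_swapPsi d k).lintegral_comp_emb (emb_swapPsi d k)] at this
    simpa only [enorm_mul, mul_pow, weightS_sq, wsq_swap] using this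
  have e3 : (fun ζ => (weightS d k α ζ : ℂ) * Hfun j a ζ) =
      (fun ζ => (weightS d k α ζ : ℂ) * Gfun j a (cneg a) (PsiE d k ζ)) -
      (fun ζ => (weightS d k α ζ : ℂ) * Gfun j (cneg a) a (PsiE d k ζ).swap) := by
    ext ζ
    simp [Hfun, mul_sub]
  rw [e3]
  refine (eLpNorm_sub_le ?_ ?_ (by norm_num)).trans ((add_le_add e1 e2).trans_eq (by ring))
  · exact (hw.mul ((continuous_G_nice j ha hb).comp (continuous_PsiE d k))).aestronglyMeasurable
  · exact (hw.mul ((continuous_G_nice j hb ha).comp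
      (continuous_swap.comp (continuous_PsiE d k)))).aestronglyMeasurable

lemma PhiE_ext {d k p : ℕ} (w : Fin k → Fin d → ℝ) (y : Fin d → ℝ) :
    PhiE d k p (toEuc _ fun q : Fin (k + p) × Fin d =>
      if h : (q.1 : ℕ) < k then w ⟨q.1, h⟩ q.2 else y q.2) = (w, fun _ => y) := by
  rw [PhiE_apply]
  simp [toEuc]

lemma contractB_eq {d k p : ℕ} (j : Fin k) {M : ℕ} (lam : Fin M → ℝ)
    (f : Fin M → SchwartzMap (EuclideanSpace ℝ (Fin (k + p) × Fin d)) ℂ) :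
    contractB d k p j (fun z : PairSpace d (k + p) =>
        ∑ i : Fin M, (lam i : ℂ) * f i (toEuc _ fun q => z (Sum.inl q)) *
          (starRingEnd ℂ) (f i (toEuc _ fun q => z (Sum.inr q)))) =
      𝓕⁻ (fun ζ : PairSpace d k => ∑ i : Fin M, (lam i : ℂ) * Hfun j (aF (𝓕 (f i))) ζ) := by
  ext z
  have hR : 𝓕⁻ (fun ζ : PairSpace d k => ∑ i : Fin M, (lam i : ℂ) * Hfun j (aF (𝓕 (f i))) ζ) z =
      ∑ i : Fin M, (lam i : ℂ) * 𝓕⁻ (Hfun j (aF (𝓕 (f i)))) z := by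
    simp only [Real.fourierInv_eq', Finset.smul_sum]
    rw [integral_finsetSum]
    · apply Finset.sum_congr rfl
      intro i _
      rw [← integral_const_mul]
      congr 1
      ext v
      simp only [smul_eq_mul]
      ring
    · intro i _
      have := (integrable_Hfun j (nice_aF (𝓕 (f i)))).const_mul (lam i : ℂ)
      exact integrable_ee_mul (φ := fun v => inner ℝ v z) this (by fun_prop)
  rw [hR]
  simp only [fourierInv_Hfun j (nice_aF _), contractB, mul_sub, Finset.sum_sub_distrib, ← mul_assoc]
  congr 1 <;>
  · apply Finset.sum_congr rfl
    intro i _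
    rw [inversion_PhiE (f i), inversion_PhiE (f i)]
    have h : ∀ g g' : Fin (k + p) × Fin d → ℝ, (fun q => (toEuc _ (Sum.elim g g')) (Sum.inl q)) = g :=
      fun _ _ => rfl
    have h' : ∀ g g' : Fin (k + p) × Fin d → ℝ, (fun q => (toEuc _ (Sum.elim g g')) (Sum.inr q)) = g' :=
      fun _ _ => rfl
    have e : ∀ b b' : Fin k × Fin d → (Fin k × Fin d) ⊕ (Fin k × Fin d),
        PhiE d k p (toEuc _ fun q : Fin (k + p) × Fin d =>
          if h : (q.1 : ℕ) < k then z (b (⟨q.1, h⟩, q.2)) else z (b' (j, q.2))) =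
        (fun l i => z (b (l, i)), fun _ i => z (b' (j, i))) := fun b b' =>
      PhiE_ext (p := p) (fun l i => z (b (l, i))) (fun i => z (b' (j, i)))
    rw [h, h']
    simp only [e]
    rfl


/-- Theorem 3.1, a priori energy bound, for nonnegative finite-rank
kernels. `d ∈ {1,2}`, `p ≥ 1`, `0 ≤ α` with `α < 1` if `d = 2` and `α ≤ 1` if `d = 1`.
There is `C_α > 0` (independent of `k`, `j` and the data) such that for every `k ≥ 1`,
`1 ≤ j ≤ k`, every finite-rank kernel `γ(x;x') = Σᵢ λᵢ fᵢ(x) conj(fᵢ(x'))` built from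
nonnegative `λᵢ` and Schwartz functions `fᵢ` on `ℝ^{d(k+p)}`,
`‖S^{(k,α)} B_{j;k+1,…,k+p} γ‖_{L²} ≤ C_α Σᵢ λᵢ ∫ ∏_{l=1}^{k+p} (1+|ξ_l|²)|f̂ᵢ(ξ)|² dξ`;
the left-hand side is expressed by Plancherel as the `L²` norm of the weighted
Fourier transform of `B_{j;k+1,…,k+p} γ`. -/
theorem a_priori_energy_bound_finite_rank
    (d p : ℕ) (hd : d = 1 ∨ d = 2) (hp : 1 ≤ p)
    (α : ℝ) (hα0 : 0 ≤ α) (hα2 : d = 2 → α < 1) (hα1 : d = 1 → α ≤ 1) :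
    ∃ C : ℝ, 0 < C ∧
      ∀ (k : ℕ), 1 ≤ k → ∀ (j : Fin k) (M : ℕ), 1 ≤ M →
        ∀ (lam : Fin M → ℝ), (∀ i, 0 ≤ lam i) →
          ∀ (f : Fin M → SchwartzMap (EuclideanSpace ℝ (Fin (k + p) × Fin d)) ℂ),
            eLpNorm
              (fun ζ : PairSpace d k =>
                (weightS d k α ζ : ℂ) *
                  𝓕 (contractB d k p j
                      (fun z : PairSpace d (k + p) =>
                        ∑ i : Fin M, (lam i : ℂ) *
                          f i (toEuc _ fun q => z (Sum.inl q)) *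
                            (starRingEnd ℂ) (f i (toEuc _ fun q => z (Sum.inr q))))) ζ)
              2 volume ≤
            ENNReal.ofReal
              (C * ∑ i : Fin M, lam i *
                ∫ ξ : EuclideanSpace ℝ (Fin (k + p) × Fin d),
                  (∏ l : Fin (k + p), (1 + ∑ i' : Fin d, (ξ (l, i')) ^ 2)) *
                    ‖𝓕 (⇑(f i)) ξ‖ ^ 2) := by
  have hle : α ≤ 1 := by
    rcases hd with h | h
    · exact hα1 h
    · exact (hα2 h).le
  have hd' : d < 2 ∨ (d = 2 ∧ α < 1) := by
    rcases hd with h | h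
    · exact Or.inl (by omega)
    · exact Or.inr ⟨h, hα2 h⟩
  obtain ⟨C, hCt, hC⟩ := conv_two (p := p) hα0 hle hd'
  have hCt' : C ^ (1 / 2 : ℝ) ≠ ⊤ := ENNReal.rpow_ne_top_of_nonneg (by norm_num) hCt
  refine ⟨2 * (C ^ (1 / 2 : ℝ)).toReal + 1, by positivity, ?_⟩
  intro k hk j M hM lam hlam f
  rw [contractB_eq]
  set G : PairSpace d k → ℂ := fun ζ => ∑ i : Fin M, (lam i : ℂ) * Hfun j (aF (𝓕 (f i))) ζ with hG
  have hGc : Continuous G := continuous_finsetSum _ fun i _ =>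
    continuous_const.mul (continuous_Hfun j (nice_aF _))
  have hGi : Integrable G := integrable_finsetSum _ fun i _ =>
    (integrable_Hfun j (nice_aF _)).const_mul _
  by_cases hF : Integrable (𝓕⁻ G)
  · have hFG : Integrable (𝓕 G) := by
      have h := hF.comp_neg
      have h2 : (fun x => 𝓕⁻ G (-x)) = 𝓕 G := by
        ext x
        rw [Real.fourierInv_eq_fourier_neg, neg_neg]
      rwa [h2] at h
    rw [hGc.fourier_fourierInv_eq hGi hFG]
    have hsum : (fun ζ : PairSpace d k => (weightS d k α ζ : ℂ) * G ζ) =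
        ∑ i : Fin M, (lam i : ℂ) • fun ζ => (weightS d k α ζ : ℂ) * Hfun j (aF (𝓕 (f i))) ζ := by
      ext ζ
      simp only [hG, Finset.mul_sum, Finset.sum_apply, Pi.smul_apply, smul_eq_mul]
      exact Finset.sum_congr rfl fun i _ => by ring
    rw [hsum]
    refine (eLpNorm_sum_le ?_ (by norm_num)).trans ?_
    · intro i _
      exact (continuous_const.mul ((Complex.continuous_ofReal.comp (continuous_weightS d k α)).mul
        (continuous_Hfun j (nice_aF (𝓕 (f i)))))).aestronglyMeasurable
    · rw [Finset.mul_sum, ENNReal.ofReal_sum_of_nonneg]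
      · refine Finset.sum_le_sum fun i _ => ?_
        rw [eLpNorm_const_smul]
        refine (mul_le_mul_right (bound_Hfun hle j C hC (nice_aF (𝓕 (f i)))) _).trans ?_
        rw [Nsq_aF, ENNReal.ofReal_mul (by positivity), ENNReal.ofReal_mul (hlam i),
          ← ofReal_norm (lam i : ℂ), Complex.norm_real, Real.norm_of_nonneg (hlam i),
          mul_left_comm]
        gcongr
        rw [ENNReal.ofReal_add (by positivity) (by norm_num), ENNReal.ofReal_mul (by norm_num),
          ENNReal.ofReal_toReal hCt']
        refine le_trans ?_ le_self_add
        simp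
      · intro i _
        refine mul_nonneg (by positivity) (mul_nonneg (hlam i) (integral_nonneg fun ξ => ?_))
        exact mul_nonneg (Finset.prod_nonneg fun l _ => by positivity) (by positivity)
  · have h0 : 𝓕 (𝓕⁻ G) = 0 := by
      ext ζ
      rw [Real.fourier_eq']
      refine integral_undef fun h => hF ?_
      have h2 := integrable_ee_mul (φ := fun v => inner ℝ v ζ) h (by fun_prop)
      refine h2.congr (Filter.Eventually.of_forall fun v => ?_)
      have : ee (inner ℝ v ζ) * Complex.exp (↑(-2 * Real.pi * inner ℝ v ζ) * Complex.I) = 1 := by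
        unfold ee
        rw [← Complex.exp_add, ← Complex.exp_zero]
        congr 1
        push_cast
        ring
      beta_reduce
      rw [smul_eq_mul, ← mul_assoc, this, one_mul]
    rw [h0]
    simp
end
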